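/- arXiv:1809.08943 — 2 statements merged into one kernel-verified Lean document; each statement's English description precedes it below -/
import Mathlib

section
/- Let K be a convex body in ℝⁿ. Then vol(K) · vol((cs K)*) ≥ (2ⁿ / C(2n,n)) · (πⁿ / n!), where C(2n,n) is the central binomial coefficient; in particular vol(K) · vol((cs K)*) ≥ (π/2)ⁿ / n!, and consequently vol(K) ≥ ((π/4)ⁿ / n!) · ∏_{i=1}^{n} λᵢ((cs K)*). -/
open MeasureTheory
open scoped RealInnerProductSpace Pointwise

noncomputable section

/-- Euclidean `n`-space. -/
abbrev E (n : ℕ) := EuclideanSpace ℝ (Fin n)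

/-- A convex body: a compact convex set with nonempty interior. -/
def IsConvexBody {n : ℕ} (K : Set (E n)) : Prop :=
  Convex ℝ K ∧ IsCompact K ∧ (interior K).Nonempty

/-- Central symmetral `cs K = (1/2)(K - K)`. -/
def csBody {n : ℕ} (K : Set (E n)) : Set (E n) := (2⁻¹ : ℝ) • (K - K)

/-- Polar body `L* = {y : ⟨x, y⟩ ≤ 1 for all x ∈ L}`. -/
def polarBody {n : ℕ} (L : Set (E n)) : Set (E n) :=
  {y | ∀ x ∈ L, ⟪x, y⟫ ≤ 1}

/-- A point of the integer lattice `ℤⁿ ⊆ ℝⁿ`. -/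
def isLatticePoint {n : ℕ} (z : E n) : Prop := ∀ j, ∃ m : ℤ, z j = (m : ℝ)

/-- The `i`-th successive minimum of `L` with respect to the lattice `ℤⁿ`:
the least `λ > 0` such that `λ • L` contains `i` linearly independent lattice points. -/
def succMin {n : ℕ} (L : Set (E n)) (i : ℕ) : ℝ :=
  sInf {lam : ℝ | 0 < lam ∧ ∃ v : Fin i → E n,
    LinearIndependent ℝ v ∧ ∀ j, isLatticePoint (v j) ∧ v j ∈ lam • L}

/-- The Jacobian matrix of a map from real to (real or complex) coordinates. -/
def jacobianMatrix {ι 𝕜 : Type*} [Fintype ι] [DecidableEq ι] [RCLike 𝕜]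
    (U : (ι → ℝ) → (ι → 𝕜)) (p : ι → ℝ) : Matrix ι ι 𝕜 :=
  Matrix.of fun i j => fderiv ℝ U p (Pi.single j 1) i

theorem differentiable_integral_of_compact_support {ι : Type*} [Fintype ι]
    {F : ℂ → (ι → ℝ) → ℂ}
    (hF : Continuous (Function.uncurry F)) (hd : ∀ p, Differentiable ℂ fun s => F s p)
    {K : Set (ι → ℝ)} (hK : IsCompact K) (hout : ∀ s, ∀ p ∉ K, F s p = 0) :
    Differentiable ℂ fun s => ∫ p, F s p := by
  have heq : (fun s => ∫ p, F s p) = fun s => ∫ p in K, F s p := by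
    ext s
    exact (setIntegral_eq_integral_of_forall_compl_eq_zero (hout s)).symm
  rw [heq]
  intro s₀
  obtain ⟨C, hC⟩ := ((isCompact_closedBall s₀ (2 : ℝ)).prod hK).exists_bound_of_continuousOn
    hF.continuousOn
  have hcs : ∀ s, Continuous (F s) := fun s => hF.comp (by fun_prop : Continuous fun p => (s, p))
  have hmeas : Measurable fun p => deriv (fun s => F s p) s₀ := by
    have := measurable_deriv_with_param (𝕜 := ℂ) (f := fun (p : ι → ℝ) (s : ℂ) => F s p)
      (hF.comp continuous_swap)
    exact this.comp (by fun_prop : Measurable fun p : ι → ℝ => (p, s₀))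
  refine (hasDerivAt_integral_of_dominated_loc_of_deriv_le (μ := volume.restrict K)
    (F := F) (F' := fun s p => deriv (fun s => F s p) s)
    (bound := fun _ => C / 1) (Metric.ball_mem_nhds s₀ one_pos)
    (.of_forall fun s => (hcs s).aestronglyMeasurable)
    ((hcs s₀).continuousOn.integrableOn_compact hK) hmeas.aestronglyMeasurable
    ?_ ?_ ?_).2.differentiableAt
  · filter_upwards [self_mem_ae_restrict hK.measurableSet] with p hp s hs
    refine Complex.norm_deriv_le_of_forall_mem_sphere_norm_le one_pos
      ((hd p).diffContOnCl) fun z hz => hC (z, p) ⟨?_, hp⟩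
    rw [Metric.mem_ball, dist_eq_norm] at hs
    rw [mem_sphere_iff_norm] at hz
    rw [mem_closedBall_iff_norm]
    calc ‖z - s₀‖ = ‖(z - s) + (s - s₀)‖ := by congr 1; ring
      _ ≤ ‖z - s‖ + ‖s - s₀‖ := norm_add_le _ _
      _ ≤ 2 := by linarith
  · exact (integrableOn_const (hK.measure_lt_top.ne))
  · filter_upwards with p s hs
    exact (hd p s).hasDerivAt

section ContourShift

variable {ι : Type*} [Fintype ι] [DecidableEq ι]

theorem jacobianMatrix_eq_zero_of_notMem_tsupport {𝕜 : Type*} [RCLike 𝕜]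
    {U : (ι → ℝ) → (ι → 𝕜)} {p : ι → ℝ} (hp : p ∉ tsupport U) : jacobianMatrix U p = 0 := by
  have h : fderiv ℝ U p = 0 := by
    by_contra h
    exact hp (support_fderiv_subset ℝ h)
  ext i j
  simp [jacobianMatrix, h]

theorem continuous_jacobianMatrix {𝕜 : Type*} [RCLike 𝕜]
    {U : (ι → ℝ) → (ι → 𝕜)} (hU : ContDiff ℝ 1 U) : Continuous (jacobianMatrix U) := by
  have := hU.continuous_fderiv one_ne_zero
  refine continuous_matrix fun i j => ?_
  simp only [jacobianMatrix, Matrix.of_apply]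
  fun_prop

theorem integral_comp_add_compactSupport_mul_det
    {U : (ι → ℝ) → (ι → ℝ)} (hU : ContDiff ℝ 1 U) (hc : HasCompactSupport U)
    (hL : ∀ p, ‖fderiv ℝ U p‖ ≤ 1 / 2) (hdet : ∀ p, 0 < (1 + jacobianMatrix U p).det)
    {g : (ι → ℝ) → ℂ} (hg : Continuous g) :
    ∫ p, (g (p + U p) * ((1 + jacobianMatrix U p).det : ℝ) - g p) = 0 := by
  have hJ := continuous_jacobianMatrix hU
  obtain ⟨R, hR⟩ := hc.isCompact.isBounded.subset_closedBall 0
  set B : Set (ι → ℝ) := Metric.closedBall 0 R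
  have hout : ∀ p ∉ B, U p = 0 ∧ jacobianMatrix U p = 0 := fun p hp =>
    ⟨image_eq_zero_of_notMem_tsupport fun h => hp (hR h),
      jacobianMatrix_eq_zero_of_notMem_tsupport fun h => hp (hR h)⟩
  have hcompact : IsCompact B := isCompact_closedBall 0 R
  rw [← setIntegral_eq_integral_of_forall_compl_eq_zero (s := B)]
  swap
  · intro p hp
    simp [(hout p hp).1, (hout p hp).2]
  have hUc := hU.continuous
  rw [integral_sub]
  rotate_left
  · refine ContinuousOn.integrableOn_compact hcompact (Continuous.continuousOn ?_)
    fun_prop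
  · exact hg.continuousOn.integrableOn_compact hcompact
  set Θ : (ι → ℝ) → (ι → ℝ) := fun p => p + U p
  have hΘ : ∀ p, HasFDerivAt Θ (ContinuousLinearMap.id ℝ _ + fderiv ℝ U p) p := fun p =>
    (hasFDerivAt_id p).add ((hU.differentiable one_ne_zero) p).hasFDerivAt
  have hlip : LipschitzWith (1 / 2) U := by
    refine lipschitzWith_of_nnnorm_fderiv_le (𝕜 := ℝ) (hU.differentiable one_ne_zero) fun p => ?_
    rw [← NNReal.coe_le_coe]
    simpa using hL p
  have happ : ApproximatesLinearOn Θ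
      ((ContinuousLinearEquiv.refl ℝ (ι → ℝ)) : (ι → ℝ) →L[ℝ] (ι → ℝ)) Set.univ (1 / 2) := by
    intro x _ y _
    have := hlip.dist_le_mul x y
    simp only [dist_eq_norm] at this
    simpa [Θ, add_sub_add_comm] using this
  have hcond : Subsingleton (ι → ℝ) ∨ (1 / 2 : NNReal) <
      ‖((ContinuousLinearEquiv.refl ℝ (ι → ℝ)).symm : (ι → ℝ) →L[ℝ] (ι → ℝ))‖₊⁻¹ := by
    rcases subsingleton_or_nontrivial (ι → ℝ) with h | h
    · exact Or.inl h
    · right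
      have : ‖((ContinuousLinearEquiv.refl ℝ (ι → ℝ)).symm : (ι → ℝ) →L[ℝ] (ι → ℝ))‖₊ = 1 := by
        rw [← NNReal.coe_inj]
        simp
      rw [this, inv_one]
      exact_mod_cast (by norm_num : (1 / 2 : ℝ) < 1)
  have hinj : Function.Injective Θ :=
    Set.injOn_univ.1 (happ.injOn hcond)
  have hsurj : Function.Surjective Θ := happ.surjective hcond
  have himage : Θ '' B = B := by
    apply Set.Subset.antisymm
    · rintro _ ⟨p, hp, rfl⟩
      by_contra h
      have h1 : Θ (Θ p) = Θ p := by simp only [Θ] at h ⊢; simp [(hout _ h).1]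
      exact h (by rw [hinj h1]; exact hp)
    · intro q hq
      obtain ⟨p, rfl⟩ := hsurj q
      refine ⟨p, ?_, rfl⟩
      by_contra h
      exact h (by simpa [Θ, (hout _ h).1] using hq)
  have key := integral_image_eq_integral_abs_det_fderiv_smul volume
    (measurableSet_closedBall (x := (0 : ι → ℝ)) (ε := R))
    (fun p _ => (hΘ p).hasFDerivWithinAt) (hinj.injOn (s := B)) g
  rw [himage] at key
  rw [sub_eq_zero, key]
  refine integral_congr_ae (.of_forall fun p => ?_)
  have hd : (ContinuousLinearMap.id ℝ (ι → ℝ) + fderiv ℝ U p).det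
      = (1 + jacobianMatrix U p).det := by
    rw [ContinuousLinearMap.det, ← LinearMap.det_toMatrix']
    congr 1
    ext i j
    simp [jacobianMatrix, LinearMap.toMatrix'_apply, Matrix.one_apply, Pi.single_apply]
  simp only [hd, abs_of_pos (hdet p), Complex.real_smul, Θ]
  ring

theorem Differentiable.eq_zero_of_eq_zero_near_zero {h : ℂ → ℂ} (hd : Differentiable ℂ h)
    {r : ℝ} (hr : 0 < r) (hz : ∀ t : ℝ, |t| < r → h t = 0) (s : ℂ) : h s = 0 := by
  have ha : AnalyticOnNhd ℂ h Set.univ := fun z _ => hd.analyticAt z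
  refine ha.eqOn_zero_of_preconnected_of_frequently_eq_zero isPreconnected_univ
    (Set.mem_univ (0 : ℂ)) ?_ (Set.mem_univ s)
  have ht : Filter.Tendsto (fun t : ℝ => (t : ℂ)) (nhdsWithin 0 {0}ᶜ) (nhdsWithin 0 {0}ᶜ) := by
    refine tendsto_nhdsWithin_iff.2 ⟨?_, ?_⟩
    · exact (Complex.continuous_ofReal.tendsto' 0 0 (by simp)).mono_left nhdsWithin_le_nhds
    · filter_upwards [self_mem_nhdsWithin] with t ht
      simpa using ht
  refine ht.frequently (Filter.Eventually.frequently ?_)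
  have : ∀ᶠ t : ℝ in nhds 0, |t| < r := by
    have := Metric.ball_mem_nhds (0 : ℝ) hr
    filter_upwards [this] with t ht
    simpa using ht
  filter_upwards [nhdsWithin_le_nhds this] with t ht using hz t ht

theorem jacobianMatrix_smul_add_smul {U₁ U₂ : (ι → ℝ) → (ι → ℝ)} (h₁ : ContDiff ℝ 1 U₁)
    (h₂ : ContDiff ℝ 1 U₂) (a b : ℝ) (p : ι → ℝ) :
    jacobianMatrix (a • U₁ + b • U₂) p = a • jacobianMatrix U₁ p + b • jacobianMatrix U₂ p := by
  have d₁ := (h₁.differentiable one_ne_zero) p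
  have d₂ := (h₂.differentiable one_ne_zero) p
  ext i j
  simp [jacobianMatrix, fderiv_add (d₁.const_smul a) (d₂.const_smul b),
    fderiv_const_smul d₁, fderiv_const_smul d₂]

theorem Matrix.differentiable_det_add_smul (M N : Matrix ι ι ℂ) :
    Differentiable ℂ fun w : ℂ => (M + w • N).det := by
  simp only [Matrix.det_apply', Matrix.add_apply, Matrix.smul_apply, smul_eq_mul]
  fun_prop

/-- The Gaussian, times the Jacobian, on the contour `p ↦ p + s U₁ p + t U₂ p` in `ℂ^ι`, minus the
Gaussian on the real contour. -/
def gaussianContourDefect (c : ℝ) (U₁ U₂ : (ι → ℝ) → (ι → ℝ)) (s t : ℂ) (p : ι → ℝ) : ℂ :=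
  Complex.exp (-c * ∑ i, (p i + s * U₁ p i + t * U₂ p i) ^ 2) *
      (1 + s • (jacobianMatrix U₁ p).map Complex.ofReal +
        t • (jacobianMatrix U₂ p).map Complex.ofReal).det -
    Complex.exp (-c * ∑ i, (p i : ℂ) ^ 2)

theorem continuous_gaussianContourDefect (c : ℝ) {U₁ U₂ : (ι → ℝ) → (ι → ℝ)}
    (h₁ : ContDiff ℝ 1 U₁) (h₂ : ContDiff ℝ 1 U₂) :
    Continuous fun q : ℂ × ℂ × (ι → ℝ) =>
    gaussianContourDefect c U₁ U₂ q.1 q.2.1 q.2.2 := by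
  have cJ₁ := continuous_jacobianMatrix h₁
  have cJ₂ := continuous_jacobianMatrix h₂
  have cU₁ := h₁.continuous
  have cU₂ := h₂.continuous
  have m₁ : Continuous fun q : ℂ × ℂ × (ι → ℝ) =>
      (jacobianMatrix U₁ q.2.2).map Complex.ofReal := by
    have := cJ₁.comp (by fun_prop : Continuous fun q : ℂ × ℂ × (ι → ℝ) => q.2.2)
    exact this.matrix_map Complex.continuous_ofReal
  have m₂ : Continuous fun q : ℂ × ℂ × (ι → ℝ) =>
      (jacobianMatrix U₂ q.2.2).map Complex.ofReal := by
    have := cJ₂.comp (by fun_prop : Continuous fun q : ℂ × ℂ × (ι → ℝ) => q.2.2)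
    exact this.matrix_map Complex.continuous_ofReal
  unfold gaussianContourDefect
  fun_prop

theorem exists_integral_gaussianContourDefect_eq_zero (c : ℝ) {U₁ U₂ : (ι → ℝ) → (ι → ℝ)}
    (h₁ : ContDiff ℝ 1 U₁) (h₂ : ContDiff ℝ 1 U₂) (hc₁ : HasCompactSupport U₁)
    (hc₂ : HasCompactSupport U₂) : ∃ r > 0, ∀ a b : ℝ, |a| < r → |b| < r →
    ∫ p, gaussianContourDefect c U₁ U₂ a b p = 0 := by
  set K := tsupport U₁ ∪ tsupport U₂
  have hK : IsCompact K := hc₁.isCompact.union hc₂.isCompact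
  have cJ₁ := continuous_jacobianMatrix h₁
  have cJ₂ := continuous_jacobianMatrix h₂
  have cU₁ := h₁.continuous
  have cU₂ := h₂.continuous
  have cf₁ := h₁.continuous_fderiv one_ne_zero
  have cf₂ := h₂.continuous_fderiv one_ne_zero
  have z₁ : ∀ p ∉ K, U₁ p = 0 ∧ jacobianMatrix U₁ p = 0 ∧ fderiv ℝ U₁ p = 0 := fun p hp =>
    ⟨image_eq_zero_of_notMem_tsupport fun h => hp (Or.inl h),
      jacobianMatrix_eq_zero_of_notMem_tsupport fun h => hp (Or.inl h),
      by by_contra h; exact hp (Or.inl (support_fderiv_subset ℝ h))⟩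
  have z₂ : ∀ p ∉ K, U₂ p = 0 ∧ jacobianMatrix U₂ p = 0 ∧ fderiv ℝ U₂ p = 0 := fun p hp =>
    ⟨image_eq_zero_of_notMem_tsupport fun h => hp (Or.inr h),
      jacobianMatrix_eq_zero_of_notMem_tsupport fun h => hp (Or.inr h),
      by by_contra h; exact hp (Or.inr (support_fderiv_subset ℝ h))⟩
  have hev : ∀ᶠ x : ℝ × ℝ in nhds (0, 0), ∀ p ∈ K,
      0 < (1 + (x.1 • jacobianMatrix U₁ p + x.2 • jacobianMatrix U₂ p)).det ∧
      ‖x.1 • fderiv ℝ U₁ p + x.2 • fderiv ℝ U₂ p‖ < 1 / 2 := by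
    refine hK.eventually_forall_of_forall_eventually fun p _ => Filter.Eventually.and ?_ ?_
    · refine Filter.Tendsto.eventually_const_lt one_pos
        (Continuous.tendsto' (by fun_prop) _ _ ?_)
      simp
    · refine Filter.Tendsto.eventually_lt_const one_half_pos
        (Continuous.tendsto' (by fun_prop) _ _ ?_)
      simp
  obtain ⟨r, hr, hball⟩ := Metric.eventually_nhds_iff_ball.1 hev
  refine ⟨r, hr, fun a b ha hb => ?_⟩
  have hab := hball (a, b) (by
    rw [Metric.mem_ball, Prod.dist_eq]; simp [ha, hb])
  have hUC : ContDiff ℝ 1 (a • U₁ + b • U₂) := (h₁.const_smul a).add (h₂.const_smul b)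
  have hfd : ∀ p, fderiv ℝ (a • U₁ + b • U₂) p = a • fderiv ℝ U₁ p + b • fderiv ℝ U₂ p := by
    intro p
    have d₁ := (h₁.differentiable one_ne_zero) p
    have d₂ := (h₂.differentiable one_ne_zero) p
    rw [fderiv_add (d₁.const_smul a) (d₂.const_smul b), fderiv_const_smul d₁,
      fderiv_const_smul d₂]
  have hcs : HasCompactSupport (a • U₁ + b • U₂) := by
    refine HasCompactSupport.intro hK fun p hp => ?_
    simp [z₁ p hp, z₂ p hp]
  have key := integral_comp_add_compactSupport_mul_det hUC hcs (fun p => ?_) (fun p => ?_)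
    (g := fun q => Complex.exp (-c * ∑ i, (q i : ℂ) ^ 2)) (by fun_prop)
  · rw [← key]
    refine integral_congr_ae (.of_forall fun p => ?_)
    simp only [gaussianContourDefect, jacobianMatrix_smul_add_smul h₁ h₂]
    congr 2
    · simp [add_assoc]
    · refine Eq.trans ?_ (RingHom.map_det Complex.ofRealHom _).symm
      congr 1
      ext i j
      by_cases hij : i = j <;>
      simp [hij, add_assoc]
  · by_cases hp : p ∈ K
    · rw [hfd]; exact (hab p hp).2.le
    · rw [hfd]; simp [z₁ p hp, z₂ p hp]
  · rw [jacobianMatrix_smul_add_smul h₁ h₂]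
    by_cases hp : p ∈ K
    · exact (hab p hp).1
    · simp [z₁ p hp, z₂ p hp]

theorem differentiable_gaussianContourDefect_left (c : ℝ) (U₁ U₂ : (ι → ℝ) → (ι → ℝ)) (t : ℂ)
    (p : ι → ℝ) : Differentiable ℂ fun s => gaussianContourDefect c U₁ U₂ s t p := by
  have : Differentiable ℂ fun s : ℂ => (1 + s • (jacobianMatrix U₁ p).map Complex.ofReal +
      t • (jacobianMatrix U₂ p).map Complex.ofReal).det := by
    simp only [add_right_comm 1 (_ • (jacobianMatrix U₁ p).map _)]
    exact Matrix.differentiable_det_add_smul _ _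
  exact (Differentiable.mul (by fun_prop) this).sub (differentiable_const _)

theorem differentiable_gaussianContourDefect_right (c : ℝ) (U₁ U₂ : (ι → ℝ) → (ι → ℝ)) (s : ℂ)
    (p : ι → ℝ) : Differentiable ℂ fun t => gaussianContourDefect c U₁ U₂ s t p :=
  (Differentiable.mul (by fun_prop) (Matrix.differentiable_det_add_smul
    (1 + s • (jacobianMatrix U₁ p).map Complex.ofReal)
      ((jacobianMatrix U₂ p).map Complex.ofReal))).sub (differentiable_const _)

theorem integral_gaussianContourDefect_eq_zero (c : ℝ) {U₁ U₂ : (ι → ℝ) → (ι → ℝ)}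
    (h₁ : ContDiff ℝ 1 U₁) (h₂ : ContDiff ℝ 1 U₂) (hc₁ : HasCompactSupport U₁)
    (hc₂ : HasCompactSupport U₂) (s t : ℂ) :
    ∫ p, gaussianContourDefect c U₁ U₂ s t p = 0 := by
  have hK : IsCompact (tsupport U₁ ∪ tsupport U₂) := hc₁.isCompact.union hc₂.isCompact
  have hout : ∀ s t : ℂ, ∀ p ∉ tsupport U₁ ∪ tsupport U₂,
      gaussianContourDefect c U₁ U₂ s t p = 0 := by
    intro s t p hp
    obtain ⟨hp₁, hp₂⟩ := not_or.1 hp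
    simp [gaussianContourDefect, image_eq_zero_of_notMem_tsupport hp₁,
      image_eq_zero_of_notMem_tsupport hp₂, jacobianMatrix_eq_zero_of_notMem_tsupport hp₁,
      jacobianMatrix_eq_zero_of_notMem_tsupport hp₂]
  have hcont := continuous_gaussianContourDefect c h₁ h₂
  obtain ⟨r, hr, hsm⟩ := exists_integral_gaussianContourDefect_eq_zero c h₁ h₂ hc₁ hc₂
  have hds : ∀ t, Differentiable ℂ fun s => ∫ p, gaussianContourDefect c U₁ U₂ s t p := fun t =>
    differentiable_integral_of_compact_support
      (F := fun s p => gaussianContourDefect c U₁ U₂ s t p)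
      (hcont.comp (f := fun q : ℂ × (ι → ℝ) => (q.1, t, q.2)) (by fun_prop))
      (differentiable_gaussianContourDefect_left c U₁ U₂ t) hK
      (fun s p hp => hout s t p hp)
  have hdt : ∀ s, Differentiable ℂ fun t => ∫ p, gaussianContourDefect c U₁ U₂ s t p := fun s =>
    differentiable_integral_of_compact_support
      (F := fun t p => gaussianContourDefect c U₁ U₂ s t p)
      (hcont.comp (f := fun q : ℂ × (ι → ℝ) => (s, q.1, q.2)) (by fun_prop))
      (differentiable_gaussianContourDefect_right c U₁ U₂ s) hK
      (fun t p hp => hout s t p hp)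
  have hreal : ∀ a : ℝ, |a| < r → ∫ p, gaussianContourDefect c U₁ U₂ a t p = 0 := fun a ha =>
    (hdt a).eq_zero_of_eq_zero_near_zero hr (fun b hb => hsm a b ha hb) t
  exact (hds t).eq_zero_of_eq_zero_near_zero hr hreal s

theorem integrable_exp_neg_mul_sum_sq {ι : Type*} [Fintype ι] {c : ℝ} (hc : 0 < c) :
    Integrable fun p : ι → ℝ => Real.exp (-c * ∑ i, p i ^ 2) := by
  have := (GaussianFourier.integrable_cexp_neg_mul_sum_add (b := c) (ι := ι) (by simpa using hc)
    0).norm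
  refine this.congr (.of_forall fun p => ?_)
  simp only [Complex.norm_exp]
  congr 1
  simp [← Complex.ofReal_pow, ← Complex.ofReal_sum]

theorem norm_jacobianMatrix_apply_le {𝕜 : Type*} [RCLike 𝕜] (U : (ι → ℝ) → (ι → 𝕜)) (p : ι → ℝ)
    (i j : ι) : ‖jacobianMatrix U p i j‖ ≤ ‖fderiv ℝ U p‖ := by
  calc ‖fderiv ℝ U p (Pi.single j 1) i‖ ≤ ‖fderiv ℝ U p (Pi.single j 1)‖ := norm_le_pi_norm _ i
    _ ≤ ‖fderiv ℝ U p‖ * ‖(Pi.single j 1 : ι → ℝ)‖ := ContinuousLinearMap.le_opNorm _ _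
    _ ≤ ‖fderiv ℝ U p‖ := by simp [Pi.norm_single]

theorem Matrix.norm_det_le {A : Matrix ι ι ℂ} {x : ℝ} (h : ∀ i j, ‖A i j‖ ≤ x) :
    ‖A.det‖ ≤ (Fintype.card ι).factorial • x ^ Fintype.card ι :=
  Matrix.det_le (abv := NormedField.toAbsoluteValue ℂ) h

theorem norm_det_one_add_jacobianMatrix_le {U₁ U₂ : (ι → ℝ) → (ι → ℝ)} {D : ℝ}
    {p : ι → ℝ} (hd₁ : ‖fderiv ℝ U₁ p‖ ≤ D) (hd₂ : ‖fderiv ℝ U₂ p‖ ≤ D) :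
    ‖(1 + (1 : ℂ) • (jacobianMatrix U₁ p).map Complex.ofReal +
        Complex.I • (jacobianMatrix U₂ p).map Complex.ofReal).det‖ ≤
      (Fintype.card ι).factorial • (1 + 2 * D) ^ Fintype.card ι := by
  refine Matrix.norm_det_le fun i j => ?_
  have e₁ := (norm_jacobianMatrix_apply_le U₁ p i j).trans hd₁
  have e₂ := (norm_jacobianMatrix_apply_le U₂ p i j).trans hd₂
  have e₀ : ‖(1 : Matrix ι ι ℂ) i j‖ ≤ 1 := by
    rw [Matrix.one_apply]; split_ifs <;> simp
  simp only [Matrix.add_apply, Matrix.smul_apply, Matrix.map_apply, smul_eq_mul]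
  refine norm_add₃_le.trans ?_
  rw [one_mul, norm_mul, Complex.norm_I, one_mul, Complex.norm_real, Complex.norm_real]
  linarith

theorem norm_cexp_contour_le {ι : Type*} [Fintype ι] {c M : ℝ} (hc : 0 < c) {p u₁ u₂ : ι → ℝ}
    (hU₁ : ‖u₁‖ ≤ M) (hU₂ : ‖u₂‖ ≤ M) :
    ‖Complex.exp (-c * ∑ i, (p i + 1 * u₁ i + Complex.I * u₂ i) ^ 2)‖ ≤
      Real.exp (c * (Fintype.card ι * (2 * M ^ 2))) * Real.exp (-(c / 2) * ∑ i, p i ^ 2) := by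
  rw [Complex.norm_exp, ← Real.exp_add]
  refine Real.exp_le_exp.2 ?_
  have hre : ((-c * ∑ i, (p i + 1 * u₁ i + Complex.I * u₂ i) ^ 2 : ℂ)).re =
      -c * ∑ i, ((p i + u₁ i) ^ 2 - u₂ i ^ 2) := by
    rw [show (-c : ℂ) = ((-c : ℝ) : ℂ) by push_cast; ring, Complex.re_ofReal_mul, Complex.re_sum]
    congr 1
    refine Finset.sum_congr rfl fun i _ => ?_
    rw [pow_two, Complex.mul_re]
    simp
    ring
  rw [hre]
  have hsum : ∑ i, (p i ^ 2 / 2 - 2 * M ^ 2) ≤ ∑ i, ((p i + u₁ i) ^ 2 - u₂ i ^ 2) := by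
    refine Finset.sum_le_sum fun i _ => ?_
    have a₁ : u₁ i ^ 2 ≤ M ^ 2 := sq_le_sq.2
      (((norm_le_pi_norm u₁ i).trans hU₁).trans (le_abs_self M))
    have a₂ : u₂ i ^ 2 ≤ M ^ 2 := sq_le_sq.2
      (((norm_le_pi_norm u₂ i).trans hU₂).trans (le_abs_self M))
    nlinarith [sq_nonneg (p i + 2 * u₁ i)]
  have hsum' : ∑ i, (p i ^ 2 / 2 - 2 * M ^ 2) =
      (∑ i, p i ^ 2) / 2 - Fintype.card ι * (2 * M ^ 2) := by
    rw [Finset.sum_sub_distrib, Finset.sum_div]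
    simp
  rw [hsum'] at hsum
  nlinarith

theorem norm_cexp_neg_mul_sum_sq_le {ι : Type*} [Fintype ι] {c : ℝ} (hc : 0 < c) (p : ι → ℝ) :
    ‖Complex.exp (-c * ∑ i, (p i : ℂ) ^ 2)‖ ≤ Real.exp (-(c / 2) * ∑ i, p i ^ 2) := by
  rw [Complex.norm_exp]
  refine Real.exp_le_exp.2 ?_
  rw [show (-c * ∑ i, (p i : ℂ) ^ 2 : ℂ) = ((-c * ∑ i, p i ^ 2 : ℝ) : ℂ) by push_cast; ring,
    Complex.ofReal_re]
  have : 0 ≤ ∑ i, p i ^ 2 := Finset.sum_nonneg fun i _ => sq_nonneg _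
  nlinarith

theorem norm_gaussianContourDefect_le {c : ℝ} (hc : 0 < c) {U₁ U₂ : (ι → ℝ) → (ι → ℝ)} {M D : ℝ}
    {p : ι → ℝ} (hU₁ : ‖U₁ p‖ ≤ M) (hU₂ : ‖U₂ p‖ ≤ M) (hd₁ : ‖fderiv ℝ U₁ p‖ ≤ D)
    (hd₂ : ‖fderiv ℝ U₂ p‖ ≤ D) :
    ‖gaussianContourDefect c U₁ U₂ 1 Complex.I p‖ ≤
      (Real.exp (c * (Fintype.card ι * (2 * M ^ 2))) *
        ((Fintype.card ι).factorial • (1 + 2 * D) ^ Fintype.card ι) + 1) *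
          Real.exp (-(c / 2) * ∑ i, p i ^ 2) := by
  have hdet := norm_det_one_add_jacobianMatrix_le hd₁ hd₂
  have hexp := norm_cexp_contour_le (p := p) hc hU₁ hU₂
  have hg := norm_cexp_neg_mul_sum_sq_le hc p
  rw [add_mul, one_mul, mul_right_comm]
  refine (norm_sub_le _ _).trans (add_le_add ?_ hg)
  rw [norm_mul]
  exact mul_le_mul hexp hdet (norm_nonneg _) (by positivity)

/-- Shifting the contour of a Gaussian integral by a bounded perturbation with bounded
derivative does not change the integral. -/
theorem integral_gaussian_contour {c : ℝ} (hc : 0 < c) {U₁ U₂ : (ι → ℝ) → (ι → ℝ)} {M : ℝ}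
    (h₁ : ContDiff ℝ 1 U₁) (h₂ : ContDiff ℝ 1 U₂) (hU₁ : ∀ p, ‖U₁ p‖ ≤ M)
    (hU₂ : ∀ p, ‖U₂ p‖ ≤ M) (hd₁ : ∀ p, ‖fderiv ℝ U₁ p‖ ≤ M) (hd₂ : ∀ p, ‖fderiv ℝ U₂ p‖ ≤ M) :
    Integrable (gaussianContourDefect c U₁ U₂ 1 Complex.I) ∧
      ∫ p, gaussianContourDefect c U₁ U₂ 1 Complex.I p = 0 := by
  have hM : 0 ≤ M := (norm_nonneg _).trans (hU₁ 0)
  have hcont : ∀ {V₁ V₂ : (ι → ℝ) → (ι → ℝ)}, ContDiff ℝ 1 V₁ → ContDiff ℝ 1 V₂ →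
      Continuous (gaussianContourDefect c V₁ V₂ 1 Complex.I) := fun k₁ k₂ =>
    (continuous_gaussianContourDefect c k₁ k₂).comp
      (f := fun p : ι → ℝ => ((1 : ℂ), Complex.I, p)) (by fun_prop)
  have hInt : ∀ A : ℝ, Integrable fun p : ι → ℝ => A * Real.exp (-(c / 2) * ∑ i, p i ^ 2) :=
    fun A => (integrable_exp_neg_mul_sum_sq (half_pos hc)).const_mul A
  refine ⟨(hInt _).mono' (hcont h₁ h₂).aestronglyMeasurable (.of_forall fun p =>
    norm_gaussianContourDefect_le hc (hU₁ p) (hU₂ p) (hd₁ p) (hd₂ p)), ?_⟩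
  let χ : ContDiffBump (0 : ι → ℝ) := ⟨1, 2, one_pos, one_lt_two⟩
  have hχ : ContDiff ℝ 1 χ := χ.contDiff
  obtain ⟨C, hC⟩ := (χ.hasCompactSupport.fderiv (𝕜 := ℝ)).exists_bound_of_continuous
    (hχ.continuous_fderiv one_ne_zero)
  let s : ℕ → ℝ := fun k => ((k : ℝ) + 1)⁻¹
  have hs0 : ∀ k, 0 < s k := fun k => by positivity
  have hs1 : ∀ k, s k ≤ 1 := fun k => inv_le_one_of_one_le₀ (by simp)
  have hst : Filter.Tendsto s Filter.atTop (nhds 0) := by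
    simpa [s] using tendsto_one_div_add_atTop_nhds_zero_nat (𝕜 := ℝ)
  let ψ : ℕ → (ι → ℝ) → ℝ := fun k p => χ (s k • p)
  have hψ : ∀ k, ContDiff ℝ 1 (ψ k) := fun k => hχ.comp (contDiff_const_smul (s k))
  have hψd : ∀ k p, ‖fderiv ℝ (ψ k) p‖ ≤ C := by
    intro k p
    have : fderiv ℝ (ψ k) p = s k • fderiv ℝ χ (s k • p) := fderiv_comp_smul (𝕜 := ℝ) (f := χ) (s k)
    rw [this, norm_smul, Real.norm_of_nonneg (hs0 k).le]
    calc s k * ‖fderiv ℝ χ (s k • p)‖ ≤ 1 * C :=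
          mul_le_mul (hs1 k) (hC _) (norm_nonneg _) zero_le_one
      _ = C := one_mul C
  have hψ1 : ∀ k p, ‖ψ k p‖ ≤ 1 := fun k p => by
    rw [Real.norm_of_nonneg χ.nonneg]; exact χ.le_one
  have hψc : ∀ k, HasCompactSupport (ψ k) := fun k =>
    χ.hasCompactSupport.comp_smul (hs0 k).ne'
  have bU : ∀ {V : (ι → ℝ) → (ι → ℝ)}, (∀ p, ‖V p‖ ≤ M) → ∀ k p, ‖(ψ k • V) p‖ ≤ M := by
    intro V hV k p
    simp only [Pi.smul_apply', norm_smul]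
    calc ‖ψ k p‖ * ‖V p‖ ≤ 1 * M := mul_le_mul (hψ1 k p) (hV p) (norm_nonneg _) zero_le_one
      _ = M := one_mul M
  have bd : ∀ {V : (ι → ℝ) → (ι → ℝ)}, ContDiff ℝ 1 V → (∀ p, ‖V p‖ ≤ M) →
      (∀ p, ‖fderiv ℝ V p‖ ≤ M) → ∀ k p, ‖fderiv ℝ (ψ k • V) p‖ ≤ M + C * M := by
    intro V hV hVM hVd k p
    rw [fderiv_smul ((hψ k).differentiable one_ne_zero p) (hV.differentiable one_ne_zero p)]
    refine (norm_add_le _ _).trans (add_le_add ?_ ?_)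
    · rw [norm_smul]
      calc ‖ψ k p‖ * ‖fderiv ℝ V p‖ ≤ 1 * M :=
            mul_le_mul (hψ1 k p) (hVd p) (norm_nonneg _) zero_le_one
        _ = M := one_mul M
    · rw [ContinuousLinearMap.norm_smulRight_apply]
      exact mul_le_mul (hψd k p) (hVM p) (norm_nonneg _) ((norm_nonneg _).trans (hψd k p))
  have hlim := tendsto_integral_of_dominated_convergence (μ := (volume : Measure (ι → ℝ)))
    (F := fun k => gaussianContourDefect c (ψ k • U₁) (ψ k • U₂) 1 Complex.I)
    (f := gaussianContourDefect c U₁ U₂ 1 Complex.I) _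
    (fun k => (hcont ((hψ k).smul h₁) ((hψ k).smul h₂)).aestronglyMeasurable)
    (hInt _) (fun k => .of_forall fun p => norm_gaussianContourDefect_le hc (bU hU₁ k p)
      (bU hU₂ k p) (bd h₁ hU₁ hd₁ k p) (bd h₂ hU₂ hd₂ k p)) (.of_forall fun p => ?_)
  · have hz : ∀ k, ∫ p, gaussianContourDefect c (ψ k • U₁) (ψ k • U₂) 1 Complex.I p = 0 := fun k =>
      integral_gaussianContourDefect_eq_zero c ((hψ k).smul h₁) ((hψ k).smul h₂)
        (hψc k).smul_right (hψc k).smul_right 1 Complex.I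
    simp only [hz] at hlim
    exact (tendsto_nhds_unique hlim tendsto_const_nhds)
  · refine tendsto_const_nhds.congr' ?_
    have hev : ∀ᶠ k in Filter.atTop, s k * ‖p‖ < 1 := by
      have : Filter.Tendsto (fun k => s k * ‖p‖) Filter.atTop (nhds (0 * ‖p‖)) :=
        hst.mul_const _
      rw [zero_mul] at this
      exact this.eventually_lt_const one_pos
    filter_upwards [hev] with k hk
    have hone : ∀ᶠ q in nhds p, ψ k q = 1 := by
      have hc' : Continuous fun q : ι → ℝ => s k * ‖q‖ := by fun_prop
      filter_upwards [hc'.continuousAt.eventually_lt continuousAt_const hk] with q hq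
      refine χ.one_of_mem_closedBall ?_
      simp only [mem_closedBall_zero_iff, norm_smul, Real.norm_of_nonneg (hs0 k).le]
      exact hq.le
    have hloc : ∀ V : (ι → ℝ) → (ι → ℝ), (ψ k • V) p = V p ∧
        jacobianMatrix (ψ k • V) p = jacobianMatrix V p := by
      intro V
      have he : ψ k • V =ᶠ[nhds p] V := by
        filter_upwards [hone] with q hq
        simp [hq]
      refine ⟨he.eq_of_nhds, ?_⟩
      ext i j
      simp only [jacobianMatrix, he.fderiv_eq]
    simp only [gaussianContourDefect, (hloc _).1, (hloc _).2]

end ContourShift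

section FunctionalInequality

variable {ι : Type*} [Fintype ι]

/-- The map `(x, y) ↦ (g₁ x + h₁ y, g₂ x + h₂ y)`, in coordinates indexed by `ι ⊕ ι`. -/
def blockMap {ι : Type*} (g₁ h₁ g₂ h₂ : (ι → ℝ) → (ι → ℝ)) (p : ι ⊕ ι → ℝ) : ι ⊕ ι → ℝ :=
  Sum.elim (g₁ (p ∘ Sum.inl) + h₁ (p ∘ Sum.inr)) (g₂ (p ∘ Sum.inl) + h₂ (p ∘ Sum.inr))

theorem contDiff_blockMap {g₁ h₁ g₂ h₂ : (ι → ℝ) → (ι → ℝ)} (hg₁ : ContDiff ℝ 1 g₁)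
    (hh₁ : ContDiff ℝ 1 h₁) (hg₂ : ContDiff ℝ 1 g₂) (hh₂ : ContDiff ℝ 1 h₂) :
    ContDiff ℝ 1 (blockMap g₁ h₁ g₂ h₂) := by
  have hl : ContDiff ℝ 1 fun p : ι ⊕ ι → ℝ => p ∘ Sum.inl := by
    refine contDiff_pi.2 fun i => ?_
    simp only [Function.comp_apply]
    fun_prop
  have hr : ContDiff ℝ 1 fun p : ι ⊕ ι → ℝ => p ∘ Sum.inr := by
    refine contDiff_pi.2 fun i => ?_
    simp only [Function.comp_apply]
    fun_prop
  refine contDiff_pi.2 fun i => ?_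
  rcases i with i | i
  · exact (contDiff_pi.1 ((hg₁.comp hl).add (hh₁.comp hr))) i
  · exact (contDiff_pi.1 ((hg₂.comp hl).add (hh₂.comp hr))) i

theorem jacobianMatrix_blockMap [DecidableEq ι] {g₁ h₁ g₂ h₂ : (ι → ℝ) → (ι → ℝ)}
    (hg₁ : ContDiff ℝ 1 g₁) (hh₁ : ContDiff ℝ 1 h₁) (hg₂ : ContDiff ℝ 1 g₂)
    (hh₂ : ContDiff ℝ 1 h₂) (p : ι ⊕ ι → ℝ) :
    jacobianMatrix (blockMap g₁ h₁ g₂ h₂) p =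
      Matrix.fromBlocks (jacobianMatrix g₁ (p ∘ Sum.inl)) (jacobianMatrix h₁ (p ∘ Sum.inr))
        (jacobianMatrix g₂ (p ∘ Sum.inl)) (jacobianMatrix h₂ (p ∘ Sum.inr)) := by
  let l : (ι ⊕ ι → ℝ) →L[ℝ] (ι → ℝ) := ContinuousLinearMap.pi fun i => .proj (Sum.inl i)
  let r : (ι ⊕ ι → ℝ) →L[ℝ] (ι → ℝ) := ContinuousLinearMap.pi fun i => .proj (Sum.inr i)
  have d : ∀ {g : (ι → ℝ) → (ι → ℝ)}, ContDiff ℝ 1 g → ∀ x, HasFDerivAt g (fderiv ℝ g x) x :=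
    fun hg x => (hg.differentiable one_ne_zero x).hasFDerivAt
  have d₁ : HasFDerivAt (fun q : ι ⊕ ι → ℝ => g₁ (l q) + h₁ (r q))
      ((fderiv ℝ g₁ (l p)).comp l + (fderiv ℝ h₁ (r p)).comp r) p :=
    ((d hg₁ (l p)).comp p l.hasFDerivAt).add ((d hh₁ (r p)).comp p r.hasFDerivAt)
  have d₂ : HasFDerivAt (fun q : ι ⊕ ι → ℝ => g₂ (l q) + h₂ (r q))
      ((fderiv ℝ g₂ (l p)).comp l + (fderiv ℝ h₂ (r p)).comp r) p :=
    ((d hg₂ (l p)).comp p l.hasFDerivAt).add ((d hh₂ (r p)).comp p r.hasFDerivAt)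
  have hd := fun q => (contDiff_blockMap hg₁ hh₁ hg₂ hh₂).differentiable one_ne_zero q
  have e : ∀ i j, jacobianMatrix (blockMap g₁ h₁ g₂ h₂) p i j =
      fderiv ℝ (fun q => blockMap g₁ h₁ g₂ h₂ q i) p (Pi.single j 1) := by
    intro i j
    rw [fderiv_apply (hd p)]
    rfl
  have ll : ∀ j, l (Pi.single (Sum.inl j) 1) = Pi.single j 1 := fun j => by
    ext i; simp [l, Pi.single_apply]
  have lr : ∀ j, l (Pi.single (Sum.inr j) 1) = 0 := fun j => by
    ext i; simp [l]
  have rl : ∀ j, r (Pi.single (Sum.inl j) 1) = 0 := fun j => by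
    ext i; simp [r]
  have rr : ∀ j, r (Pi.single (Sum.inr j) 1) = Pi.single j 1 := fun j => by
    ext i; simp [r, Pi.single_apply]
  ext i j
  rw [e]
  rcases i with i | i
  · have : fderiv ℝ (fun q => blockMap g₁ h₁ g₂ h₂ q (Sum.inl i)) p = _ :=
      (hasFDerivAt_pi'.1 d₁ i).fderiv
    rw [this]
    rcases j with j | j <;> simp [ll, lr, rl, rr, jacobianMatrix] <;> rfl
  · have : fderiv ℝ (fun q => blockMap g₁ h₁ g₂ h₂ q (Sum.inr i)) p = _ :=
      (hasFDerivAt_pi'.1 d₂ i).fderiv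
    rw [this]
    rcases j with j | j <;> simp [ll, lr, rl, rr, jacobianMatrix] <;> rfl

theorem lipschitzWith_blockMap {g₁ h₁ g₂ h₂ : (ι → ℝ) → (ι → ℝ)} {C : NNReal}
    (hg₁ : LipschitzWith C g₁) (hh₁ : LipschitzWith C h₁) (hg₂ : LipschitzWith C g₂)
    (hh₂ : LipschitzWith C h₂) : LipschitzWith (C + C) (blockMap g₁ h₁ g₂ h₂) := by
  refine LipschitzWith.of_dist_le_mul fun p q => ?_
  have hl : dist (p ∘ Sum.inl) (q ∘ Sum.inl) ≤ dist p q :=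
    (dist_pi_le_iff dist_nonneg).2 fun i => dist_le_pi_dist p q (Sum.inl i)
  have hr : dist (p ∘ Sum.inr) (q ∘ Sum.inr) ≤ dist p q :=
    (dist_pi_le_iff dist_nonneg).2 fun i => dist_le_pi_dist p q (Sum.inr i)
  have key : ∀ {g h : (ι → ℝ) → (ι → ℝ)}, LipschitzWith C g → LipschitzWith C h → ∀ i,
      dist ((g (p ∘ Sum.inl) + h (p ∘ Sum.inr)) i) ((g (q ∘ Sum.inl) + h (q ∘ Sum.inr)) i) ≤
        (C + C : NNReal) * dist p q := by
    intro g h hg hh i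
    refine (dist_le_pi_dist _ _ i).trans ((dist_add_add_le _ _ _ _).trans ?_)
    rw [NNReal.coe_add, add_mul]
    exact add_le_add ((hg.dist_le_mul _ _).trans (by gcongr))
      ((hh.dist_le_mul _ _).trans (by gcongr))
  refine (dist_pi_le_iff (by positivity)).2 fun i => ?_
  rcases i with i | i
  · exact key hg₁ hh₁ i
  · exact key hg₂ hh₂ i

theorem norm_blockMap_le {g₁ h₁ g₂ h₂ : (ι → ℝ) → (ι → ℝ)} {M : ℝ}
    (hg₁ : ∀ x, ‖g₁ x‖ ≤ M) (hh₁ : ∀ x, ‖h₁ x‖ ≤ M) (hg₂ : ∀ x, ‖g₂ x‖ ≤ M)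
    (hh₂ : ∀ x, ‖h₂ x‖ ≤ M) (p : ι ⊕ ι → ℝ) : ‖blockMap g₁ h₁ g₂ h₂ p‖ ≤ M + M := by
  have hM : 0 ≤ M := (norm_nonneg _).trans (hg₁ 0)
  refine (pi_norm_le_iff_of_nonneg (by positivity)).2 fun i => ?_
  rcases i with i | i
  · exact (norm_le_pi_norm _ i).trans ((norm_add_le _ _).trans (add_le_add (hg₁ _) (hh₁ _)))
  · exact (norm_le_pi_norm _ i).trans ((norm_add_le _ _).trans (add_le_add (hg₂ _) (hh₂ _)))

theorem jacobianMatrix_const_smul [DecidableEq ι] {v : (ι → ℝ) → (ι → ℝ)} (hv : ContDiff ℝ 1 v)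
    (a : ℝ) (x : ι → ℝ) : jacobianMatrix (a • v) x = a • jacobianMatrix v x := by
  ext i j
  simp [jacobianMatrix, fderiv_const_smul (hv.differentiable one_ne_zero x)]

theorem jacobianMatrix_zero [DecidableEq ι] (x : ι → ℝ) :
    jacobianMatrix (0 : (ι → ℝ) → (ι → ℝ)) x = 0 := by
  ext i j
  simp [jacobianMatrix]

theorem jacobianMatrix_smul_id_add [DecidableEq ι] {v : (ι → ℝ) → (ι → ℝ)} (hv : ContDiff ℝ 1 v)
    (a b : ℝ) (x : ι → ℝ) :
    jacobianMatrix (a • id + b • v) x = a • (1 : Matrix ι ι ℝ) + b • jacobianMatrix v x := by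
  rw [jacobianMatrix_smul_add_smul contDiff_id hv]
  congr 2
  ext i j
  simp [jacobianMatrix, Matrix.one_apply, Pi.single_apply]

theorem det_fromBlocks_complex_shear [DecidableEq ι] (P Q : Matrix ι ι ℂ) :
    (Matrix.fromBlocks (1 + P) (-(Complex.I • Q)) (Complex.I • P) (1 + Q)).det =
      (1 + P + Q).det := by
  have h := Matrix.det_mul (Matrix.fromBlocks 1 (Complex.I • (1 : Matrix ι ι ℂ)) 0 1)
    (Matrix.fromBlocks (1 + P) (-(Complex.I • Q)) (Complex.I • P) (1 + Q))
  rw [Matrix.det_fromBlocks_zero₂₁, Matrix.det_one, one_mul, one_mul,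
    Matrix.fromBlocks_multiply] at h
  rw [← h]
  have e₁ : (1 : Matrix ι ι ℂ) * (1 + P) + Complex.I • (1 : Matrix ι ι ℂ) * Complex.I • P = 1 := by
    simp [smul_smul]
  have e₂ : (1 : Matrix ι ι ℂ) * -(Complex.I • Q) + Complex.I • (1 : Matrix ι ι ℂ) * (1 + Q) =
      Complex.I • 1 := by
    simp
  have e₃ : (0 : Matrix ι ι ℂ) * (1 + P) + 1 * Complex.I • P = Complex.I • P := by simp
  have e₄ : (0 : Matrix ι ι ℂ) * -(Complex.I • Q) + 1 * (1 + Q) = 1 + Q := by simp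
  rw [e₁, e₂, e₃, e₄, Matrix.det_fromBlocks_one₁₁]
  congr 1
  simp [smul_smul]
  abel

theorem det_fromBlocks_half_half [DecidableEq ι] (C D : Matrix ι ι ℝ) :
    (Matrix.fromBlocks ((2⁻¹ : ℝ) • 1) ((2⁻¹ : ℝ) • 1) C D).det =
      2⁻¹ ^ Fintype.card ι * (D - C).det := by
  have h := Matrix.det_mul (Matrix.fromBlocks ((2⁻¹ : ℝ) • 1) ((2⁻¹ : ℝ) • 1) C D)
    (Matrix.fromBlocks 1 (-1 : Matrix ι ι ℝ) 0 1)
  rw [Matrix.det_fromBlocks_zero₂₁, Matrix.det_one, one_mul, mul_one,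
    Matrix.fromBlocks_multiply] at h
  rw [← h]
  have e₁ : ((2⁻¹ : ℝ) • (1 : Matrix ι ι ℝ)) * -1 + ((2⁻¹ : ℝ) • (1 : Matrix ι ι ℝ)) * 1 = 0 := by
    simp
  rw [e₁, Matrix.det_fromBlocks_zero₁₂]
  simp [neg_add_eq_sub]

/-- The real part of the contour. -/
def contourRe {ι : Type*} (v : (ι → ℝ) → (ι → ℝ)) : (ι ⊕ ι → ℝ) → (ι ⊕ ι → ℝ) :=
  blockMap ((2⁻¹ : ℝ) • v) 0 0 ((2⁻¹ : ℝ) • v)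

/-- The imaginary part of the contour. -/
def contourIm {ι : Type*} (v : (ι → ℝ) → (ι → ℝ)) : (ι ⊕ ι → ℝ) → (ι ⊕ ι → ℝ) :=
  blockMap 0 ((-2⁻¹ : ℝ) • v) ((2⁻¹ : ℝ) • v) 0

theorem det_contour [DecidableEq ι] {v : (ι → ℝ) → (ι → ℝ)} (hv : ContDiff ℝ 1 v)
    (p : ι ⊕ ι → ℝ) :
    (1 + (1 : ℂ) • (jacobianMatrix (contourRe v) p).map Complex.ofReal +
        Complex.I • (jacobianMatrix (contourIm v) p).map Complex.ofReal).det =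
      ((1 + (2⁻¹ : ℝ) • jacobianMatrix v (p ∘ Sum.inl) +
        (2⁻¹ : ℝ) • jacobianMatrix v (p ∘ Sum.inr)).det : ℝ) := by
  have hs : ∀ a : ℝ, ContDiff ℝ 1 (a • v) := fun a => hv.const_smul a
  have z : ContDiff ℝ 1 (0 : (ι → ℝ) → (ι → ℝ)) := contDiff_const
  rw [contourRe, contourIm, jacobianMatrix_blockMap (hs _) z z (hs _),
    jacobianMatrix_blockMap z (hs _) (hs _) z]
  simp only [jacobianMatrix_const_smul hv, jacobianMatrix_zero]
  have := det_fromBlocks_complex_shear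
    (((2⁻¹ : ℝ) • jacobianMatrix v (p ∘ Sum.inl)).map Complex.ofReal)
    (((2⁻¹ : ℝ) • jacobianMatrix v (p ∘ Sum.inr)).map Complex.ofReal)
  refine Eq.trans ?_ (this.trans ?_)
  · congr 1
    ext i j
    rcases i with i | i <;> rcases j with j | j <;> simp [Matrix.one_apply]
  · refine Eq.trans ?_ (RingHom.map_det Complex.ofRealHom _).symm
    congr 1
    ext i j
    by_cases hij : i = j <;> simp [hij]

theorem norm_cexp_contour (v : (ι → ℝ) → (ι → ℝ)) (c : ℝ) (p : ι ⊕ ι → ℝ) :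
    ‖Complex.exp (-c * ∑ i, (p i + 1 * contourRe v p i + Complex.I * contourIm v p i) ^ 2)‖ =
      Real.exp (-c * ((p ∘ Sum.inl) ⬝ᵥ (p ∘ Sum.inl + v (p ∘ Sum.inl)) +
        (p ∘ Sum.inr) ⬝ᵥ (p ∘ Sum.inr + v (p ∘ Sum.inr)))) := by
  rw [Complex.norm_exp]
  congr 1
  rw [show (-c : ℂ) = ((-c : ℝ) : ℂ) by push_cast; ring, Complex.re_ofReal_mul, Complex.re_sum,
    Fintype.sum_sum_type]
  congr 1
  simp only [dotProduct, ← Finset.sum_add_distrib]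
  refine Finset.sum_congr rfl fun i _ => ?_
  simp only [contourRe, contourIm, blockMap, Sum.elim_inl, Sum.elim_inr, Pi.add_apply,
    Pi.smul_apply, Pi.zero_apply, smul_eq_mul, pow_two, Complex.mul_re, Complex.add_re,
    Complex.ofReal_re, Complex.ofReal_im, Complex.add_im, Complex.mul_im, Complex.I_re,
    Complex.I_im, Complex.one_re, Complex.one_im, Function.comp_apply]
  ring

theorem integral_cexp_neg_mul_sum_sq_sum {c : ℝ} (hc : 0 < c) :
    ∫ p : ι ⊕ ι → ℝ, Complex.exp (-c * ∑ i, (p i : ℂ) ^ 2) =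
      ((Real.pi / c) ^ Fintype.card ι : ℝ) := by
  have := GaussianFourier.integral_cexp_neg_mul_sum_add (b := c) (ι := ι ⊕ ι) (by simpa using hc) 0
  simp only [Pi.zero_apply, zero_mul, Finset.sum_const_zero, add_zero] at this
  rw [this, Fintype.card_sum]
  push_cast
  rw [show ((Fintype.card ι : ℂ) + Fintype.card ι) / 2 = (Fintype.card ι : ℕ) by ring,
    Complex.cpow_natCast]
  simp

theorem ofReal_pi_pow_le_lintegral_contour [DecidableEq ι] {v : (ι → ℝ) → (ι → ℝ)}
    (hv : ContDiff ℝ 1 v)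
    {M : ℝ} (hM : ∀ x, ‖v x‖ ≤ M) {C : NNReal} (hC : LipschitzWith C v) {c : ℝ} (hc : 0 < c) :
    ENNReal.ofReal ((Real.pi / c) ^ Fintype.card ι) ≤
      ∫⁻ p : ι ⊕ ι → ℝ, ENNReal.ofReal
        (Real.exp (-c * ((p ∘ Sum.inl) ⬝ᵥ (p ∘ Sum.inl + v (p ∘ Sum.inl)) +
          (p ∘ Sum.inr) ⬝ᵥ (p ∘ Sum.inr + v (p ∘ Sum.inr)))) *
        |(1 + (2⁻¹ : ℝ) • jacobianMatrix v (p ∘ Sum.inl) +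
          (2⁻¹ : ℝ) • jacobianMatrix v (p ∘ Sum.inr)).det|) := by
  have hs : ∀ a : ℝ, ContDiff ℝ 1 (a • v) := fun a => hv.const_smul a
  have z : ContDiff ℝ 1 (0 : (ι → ℝ) → (ι → ℝ)) := contDiff_const
  have M0 : 0 ≤ M := (norm_nonneg _).trans (hM 0)
  have zl : LipschitzWith C (0 : (ι → ℝ) → (ι → ℝ)) := (LipschitzWith.const 0).weaken zero_le
  have zM : ∀ x, ‖(0 : (ι → ℝ) → (ι → ℝ)) x‖ ≤ M := fun x => by simpa using M0
  have sM : ∀ a : ℝ, |a| ≤ 1 → ∀ x, ‖(a • v) x‖ ≤ M := fun a ha x => by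
    rw [Pi.smul_apply, norm_smul]
    calc _ ≤ 1 * M := mul_le_mul ha (hM x) (norm_nonneg _) zero_le_one
      _ = M := one_mul M
  have sl : ∀ a : ℝ, |a| ≤ 1 → LipschitzWith C (a • v) := fun a ha =>
    LipschitzWith.of_dist_le_mul fun x y => by
      simp only [Pi.smul_apply, dist_smul₀]
      calc _ ≤ 1 * (C * dist x y) := mul_le_mul ha (hC.dist_le_mul x y) dist_nonneg zero_le_one
        _ = _ := one_mul _
  have h2 : |(2⁻¹ : ℝ)| ≤ 1 := by rw [abs_of_pos] <;> norm_num
  have h2' : |(-2⁻¹ : ℝ)| ≤ 1 := by rw [abs_neg, abs_of_pos] <;> norm_num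
  have key := integral_gaussian_contour (U₁ := contourRe v) (U₂ := contourIm v)
    (M := max (M + M) (C + C : NNReal)) hc
    (contDiff_blockMap (hs _) z z (hs _))
    (contDiff_blockMap z (hs _) (hs _) z)
    (fun p => (norm_blockMap_le (sM _ h2) zM zM (sM _ h2) p).trans (le_max_left _ _))
    (fun p => (norm_blockMap_le zM (sM _ h2') (sM _ h2) zM p).trans (le_max_left _ _))
    (fun p => (norm_fderiv_le_of_lipschitz ℝ
      (lipschitzWith_blockMap (sl _ h2) zl zl (sl _ h2))).trans (le_max_right _ _))
    (fun p => (norm_fderiv_le_of_lipschitz ℝ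
      (lipschitzWith_blockMap zl (sl _ h2') (sl _ h2) zl)).trans (le_max_right _ _))
  have hG : Integrable fun p : ι ⊕ ι → ℝ => Complex.exp (-c * ∑ i, (p i : ℂ) ^ 2) := by
    simpa using GaussianFourier.integrable_cexp_neg_mul_sum_add (b := c) (ι := ι ⊕ ι)
      (by simpa using hc) 0
  have hsum := key.1.add hG
  have hval := integral_add key.1 hG
  rw [key.2, zero_add, integral_cexp_neg_mul_sum_sq_sum hc] at hval
  have hle := enorm_integral_le_lintegral_enorm (μ := (volume : Measure (ι ⊕ ι → ℝ)))
    (fun p => gaussianContourDefect c (contourRe v) (contourIm v) 1 Complex.I p +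
      Complex.exp (-c * ∑ i, (p i : ℂ) ^ 2))
  rw [hval, ← ofReal_norm, Complex.norm_real, Real.norm_of_nonneg (by positivity)] at hle
  refine hle.trans_eq (lintegral_congr fun p => ?_)
  rw [gaussianContourDefect, sub_add_cancel, ← ofReal_norm, norm_mul, norm_cexp_contour,
    det_contour hv, Complex.norm_real, Real.norm_eq_abs]

theorem det_fderiv_eq_det_jacobianMatrix [DecidableEq ι] (U : (ι → ℝ) → (ι → ℝ)) (p : ι → ℝ) :
    (fderiv ℝ U p).det = (jacobianMatrix U p).det := by
  rw [ContinuousLinearMap.det, ← LinearMap.det_toMatrix']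
  rfl

/-- The map `(x, y) ↦ ((x + y) / 2, (f x - f y) / 2)`, for `f x = ε (x + v x)`. -/
def midpointMap {ι : Type*} (ε : ℝ) (v : (ι → ℝ) → (ι → ℝ)) : (ι ⊕ ι → ℝ) → (ι ⊕ ι → ℝ) :=
  blockMap ((2⁻¹ : ℝ) • id) ((2⁻¹ : ℝ) • id) ((ε * 2⁻¹) • id + (ε * 2⁻¹) • v)
    ((-(ε * 2⁻¹)) • id + (-(ε * 2⁻¹)) • v)

theorem contDiff_midpointMap {ε : ℝ} {v : (ι → ℝ) → (ι → ℝ)} (hv : ContDiff ℝ 1 v) :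
    ContDiff ℝ 1 (midpointMap ε v) :=
  contDiff_blockMap (contDiff_const.smul contDiff_id) (contDiff_const.smul contDiff_id)
    ((contDiff_const.smul contDiff_id).add (contDiff_const.smul hv))
    ((contDiff_const.smul contDiff_id).add (contDiff_const.smul hv))

theorem abs_det_fderiv_midpointMap [DecidableEq ι] {ε : ℝ} (hε : 0 < ε) {v : (ι → ℝ) → (ι → ℝ)}
    (hv : ContDiff ℝ 1 v) (p : ι ⊕ ι → ℝ) :
    |(fderiv ℝ (midpointMap ε v) p).det| = (ε / 2) ^ Fintype.card ι *
      |(1 + (2⁻¹ : ℝ) • jacobianMatrix v (p ∘ Sum.inl) +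
          (2⁻¹ : ℝ) • jacobianMatrix v (p ∘ Sum.inr)).det| := by
  have hs : ∀ a : ℝ, ContDiff ℝ 1 (a • v) := fun a => hv.const_smul a
  have hi : ∀ a : ℝ, ContDiff ℝ 1 (a • (id : (ι → ℝ) → (ι → ℝ))) :=
    fun a => contDiff_id.const_smul a
  have hj : ∀ x : ι → ℝ, jacobianMatrix (id : (ι → ℝ) → (ι → ℝ)) x = 1 := fun x => by
    ext i j
    simp [jacobianMatrix, Matrix.one_apply, Pi.single_apply]
  have ha : ∀ a b : ℝ, ContDiff ℝ 1 (a • id + b • v) := fun a b => (hi a).add (hs b)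
  rw [det_fderiv_eq_det_jacobianMatrix, midpointMap, jacobianMatrix_blockMap (hi _) (hi _)
    (ha _ _) (ha _ _), jacobianMatrix_const_smul contDiff_id,
    jacobianMatrix_const_smul contDiff_id, hj, hj, det_fromBlocks_half_half,
    jacobianMatrix_smul_id_add hv, jacobianMatrix_smul_id_add hv, abs_mul]
  have : -(ε * 2⁻¹) • (1 : Matrix ι ι ℝ) + -(ε * 2⁻¹) • jacobianMatrix v (p ∘ Sum.inr) -
      ((ε * 2⁻¹) • (1 : Matrix ι ι ℝ) + (ε * 2⁻¹) • jacobianMatrix v (p ∘ Sum.inl)) =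
      (-ε) • (1 + (2⁻¹ : ℝ) • jacobianMatrix v (p ∘ Sum.inl) +
          (2⁻¹ : ℝ) • jacobianMatrix v (p ∘ Sum.inr)) := by
    ext i j
    simp only [Matrix.sub_apply, Matrix.add_apply, Matrix.smul_apply, smul_eq_mul]
    ring
  rw [this, Matrix.det_smul, abs_mul, ← mul_assoc, abs_pow, abs_pow, abs_neg, abs_of_pos hε,
    abs_of_pos (by norm_num), ← mul_pow]
  congr 2
  ring

theorem injective_midpointMap {ε : ℝ} (hε : 0 < ε) {v : (ι → ℝ) → (ι → ℝ)}
    (hmono : ∀ x y, 0 ≤ (x - y) ⬝ᵥ (v x - v y)) : Function.Injective (midpointMap ε v) := by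
  intro p q h
  have h₁ : ∀ i, p (Sum.inl i) + p (Sum.inr i) = q (Sum.inl i) + q (Sum.inr i) := fun i => by
    have := congrFun h (Sum.inl i)
    simp only [midpointMap, blockMap, Sum.elim_inl, Pi.add_apply, Pi.smul_apply, id,
      Function.comp_apply, smul_eq_mul] at this
    linarith
  have h₂ : ∀ i, p (Sum.inl i) + v (p ∘ Sum.inl) i - (p (Sum.inr i) + v (p ∘ Sum.inr) i) =
      q (Sum.inl i) + v (q ∘ Sum.inl) i - (q (Sum.inr i) + v (q ∘ Sum.inr) i) := fun i => by
    have := congrFun h (Sum.inr i)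
    simp only [midpointMap, blockMap, Sum.elim_inr, Pi.add_apply, Pi.smul_apply, id,
      Function.comp_apply, smul_eq_mul] at this
    have h3 : ε * 2⁻¹ ≠ 0 := by positivity
    apply mul_left_cancel₀ h3
    linarith
  have m₁ := hmono (p ∘ Sum.inl) (q ∘ Sum.inl)
  have m₂ := hmono (p ∘ Sum.inr) (q ∘ Sum.inr)
  have hz : ∑ i, (p (Sum.inl i) - q (Sum.inl i)) ^ 2 ≤ 0 := by
    simp only [dotProduct] at m₁ m₂
    have : ∑ i, 2 * (p (Sum.inl i) - q (Sum.inl i)) ^ 2 =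
      - (∑ i, (p ∘ Sum.inl - q ∘ Sum.inl) i * (v (p ∘ Sum.inl) - v (q ∘ Sum.inl)) i) -
      ∑ i, (p ∘ Sum.inr - q ∘ Sum.inr) i * (v (p ∘ Sum.inr) - v (q ∘ Sum.inr)) i := by
      rw [← Finset.sum_neg_distrib, ← Finset.sum_sub_distrib]
      refine Finset.sum_congr rfl fun i _ => ?_
      simp only [Pi.sub_apply, Function.comp_apply]
      have e₁ : p (Sum.inr i) - q (Sum.inr i) = -(p (Sum.inl i) - q (Sum.inl i)) := by
        linarith [h₁ i]
      rw [e₁]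
      linear_combination (p (Sum.inl i) - q (Sum.inl i)) * h₂ i +
        (p (Sum.inl i) - q (Sum.inl i)) * h₁ i
    rw [← Finset.mul_sum] at this
    linarith
  have hz' : ∀ i, p (Sum.inl i) - q (Sum.inl i) = 0 := fun i => by
    have h0 : ∀ i ∈ Finset.univ, 0 ≤ (p (Sum.inl i) - q (Sum.inl i)) ^ 2 := fun i _ => sq_nonneg _
    have := (Finset.sum_eq_zero_iff_of_nonneg h0).1 (le_antisymm hz (Finset.sum_nonneg h0)) i
      (Finset.mem_univ i)
    exact pow_eq_zero_iff two_ne_zero |>.1 this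
  ext i
  rcases i with i | i
  · linarith [hz' i]
  · linarith [hz' i, h₁ i]

theorem lintegral_sum_pi_mul {F G : (ι → ℝ) → ENNReal} (hF : Measurable F) (hG : Measurable G) :
    ∫⁻ p : ι ⊕ ι → ℝ, F (p ∘ Sum.inl) * G (p ∘ Sum.inr) = (∫⁻ x, F x) * ∫⁻ y, G y := by
  rw [← lintegral_prod_mul hF.aemeasurable hG.aemeasurable]
  exact (volume_measurePreserving_sumPiEquivProdPi (fun _ : ι ⊕ ι => ℝ)).lintegral_comp
    (f := fun q : (ι → ℝ) × (ι → ℝ) => F q.1 * G q.2) (by fun_prop)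

/-- A functional Blaschke–Santaló-type lower bound: if `Φ` and `Ψ` are dominated, in the midpoint
sense, by the pairing along the graph of the monotone map `f x = ε (x + v x)`, then
`π ^ n ≤ ∫ e^{-Φ} ∫ e^{-Ψ}`. -/
theorem pi_pow_le_lintegral_mul_lintegral [DecidableEq ι] {v : (ι → ℝ) → (ι → ℝ)}
    (hv : ContDiff ℝ 1 v)
    {M : ℝ} (hM : ∀ x, ‖v x‖ ≤ M) {C : NNReal} (hC : LipschitzWith C v) {ε : ℝ} (hε : 0 < ε)
    (hmono : ∀ x y, 0 ≤ (x - y) ⬝ᵥ (v x - v y)) {Φ Ψ : (ι → ℝ) → ℝ} (hΦ : Measurable Φ)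
    (hΨ : Measurable Ψ)
    (h : ∀ x y, Φ ((2⁻¹ : ℝ) • (x + y)) + Ψ ((ε / 2) • ((x + v x) - (y + v y))) ≤
      ε / 2 * (x ⬝ᵥ (x + v x) + y ⬝ᵥ (y + v y))) :
    ENNReal.ofReal (Real.pi ^ Fintype.card ι) ≤
      (∫⁻ x, ENNReal.ofReal (Real.exp (-Φ x))) * ∫⁻ x, ENNReal.ofReal (Real.exp (-Ψ x)) := by
  have h0 := ofReal_pi_pow_le_lintegral_contour hv hM hC (half_pos hε)
  have hT := contDiff_midpointMap (ε := ε) hv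
  have hcv := lintegral_image_eq_lintegral_abs_det_fderiv_mul volume MeasurableSet.univ
    (fun p _ => ((hT.differentiable one_ne_zero) p).hasFDerivAt.hasFDerivWithinAt)
    (injective_midpointMap hε hmono).injOn
    (fun q : ι ⊕ ι → ℝ => ENNReal.ofReal (Real.exp (-Φ (q ∘ Sum.inl))) *
      ENNReal.ofReal (Real.exp (-Ψ (q ∘ Sum.inr))))
  rw [← lintegral_sum_pi_mul (by fun_prop) (by fun_prop)]
  refine le_trans ?_ (setLIntegral_le_lintegral (midpointMap ε v '' Set.univ) _)
  rw [hcv, Measure.restrict_univ]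
  have e : Real.pi ^ Fintype.card ι =
      (ε / 2) ^ Fintype.card ι * (Real.pi / (ε / 2)) ^ Fintype.card ι := by
    rw [← mul_pow]
    congr 1
    field_simp
  rw [e, ENNReal.ofReal_mul (by positivity)]
  refine (mul_le_mul_right h0 _).trans ?_
  rw [← lintegral_const_mul' _ _ ENNReal.ofReal_ne_top]
  refine lintegral_mono fun p => ?_
  have hp : midpointMap ε v p ∘ Sum.inl = (2⁻¹ : ℝ) • (p ∘ Sum.inl + p ∘ Sum.inr) := by
    ext i
    simp [midpointMap, blockMap, mul_add]
  have hp' : midpointMap ε v p ∘ Sum.inr = (ε / 2) • ((p ∘ Sum.inl + v (p ∘ Sum.inl)) -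
      (p ∘ Sum.inr + v (p ∘ Sum.inr))) := by
    ext i
    simp [midpointMap, blockMap]
    ring
  rw [abs_det_fderiv_midpointMap hε hv, hp, hp', ← ENNReal.ofReal_mul (by positivity),
    ← ENNReal.ofReal_mul (by positivity), ← ENNReal.ofReal_mul (by positivity), ← Real.exp_add]
  refine ENNReal.ofReal_le_ofReal ?_
  rw [mul_comm (Real.exp _), ← mul_assoc]
  refine mul_le_mul_of_nonneg_left (Real.exp_le_exp.2 ?_) (by positivity)
  have := h (p ∘ Sum.inl) (p ∘ Sum.inr)
  linarith

end FunctionalInequality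

section Cutoff

/-- An odd, bounded, smooth, nondecreasing function vanishing exactly on `[-1, 1]`. -/
def cutoffSlope (t : ℝ) : ℝ := Real.smoothTransition (t - 1) - Real.smoothTransition (-t - 1)

/-- The primitive of `cutoffSlope`: a convex function vanishing exactly on `[-1, 1]`. -/
def cutoff (t : ℝ) : ℝ := ∫ r in (0 : ℝ)..t, cutoffSlope r

theorem contDiff_cutoffSlope : ContDiff ℝ 1 cutoffSlope := by
  have h : ContDiff ℝ 1 Real.smoothTransition := Real.smoothTransition.contDiff (n := 1)
  unfold cutoffSlope
  fun_prop

theorem continuous_cutoffSlope : Continuous cutoffSlope := contDiff_cutoffSlope.continuous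

theorem monotone_cutoffSlope : Monotone cutoffSlope := fun _ _ h =>
  sub_le_sub (Real.smoothTransition.monotone (by linarith))
    (Real.smoothTransition.monotone (by linarith))

theorem norm_cutoffSlope_le (t : ℝ) : ‖cutoffSlope t‖ ≤ 1 := by
  rw [Real.norm_eq_abs, abs_le, cutoffSlope]
  constructor <;> linarith [Real.smoothTransition.nonneg (t - 1),
    Real.smoothTransition.nonneg (-t - 1), Real.smoothTransition.le_one (t - 1),
    Real.smoothTransition.le_one (-t - 1)]

theorem cutoffSlope_eq_zero {t : ℝ} (h : |t| ≤ 1) : cutoffSlope t = 0 := by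
  rw [abs_le] at h
  rw [cutoffSlope, Real.smoothTransition.zero_of_nonpos (by linarith),
    Real.smoothTransition.zero_of_nonpos (by linarith), sub_zero]

theorem cutoffSlope_pos {t : ℝ} (h : 1 < t) : 0 < cutoffSlope t := by
  rw [cutoffSlope, Real.smoothTransition.zero_of_nonpos (x := -t - 1) (by linarith), sub_zero]
  exact Real.smoothTransition.pos_of_pos (by linarith)

theorem exists_norm_deriv_cutoffSlope_le : ∃ C, ∀ t, ‖deriv cutoffSlope t‖ ≤ C := by
  refine HasCompactSupport.exists_bound_of_continuous ?_
    (contDiff_cutoffSlope.continuous_deriv_one)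
  refine HasCompactSupport.intro (isCompact_Icc (a := (-2 : ℝ)) (b := 2)) fun t ht => ?_
  rw [Set.mem_Icc, not_and_or, not_le, not_le] at ht
  rcases ht with ht | ht
  · have : cutoffSlope =ᶠ[nhds t] fun _ => -1 := by
      filter_upwards [Iio_mem_nhds ht] with r hr
      have hr : r < -2 := hr
      rw [cutoffSlope, Real.smoothTransition.zero_of_nonpos (by linarith),
        Real.smoothTransition.one_of_one_le (by linarith), zero_sub]
    rw [this.deriv_eq, deriv_const]
  · have : cutoffSlope =ᶠ[nhds t] fun _ => 1 := by
      filter_upwards [Ioi_mem_nhds ht] with r hr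
      have hr : 2 < r := hr
      rw [cutoffSlope, Real.smoothTransition.zero_of_nonpos (x := -r - 1) (by linarith),
        Real.smoothTransition.one_of_one_le (by linarith), sub_zero]
    rw [this.deriv_eq, deriv_const]

theorem continuous_cutoff : Continuous cutoff :=
  intervalIntegral.continuous_primitive
    (fun _ _ => continuous_cutoffSlope.intervalIntegrable _ _) 0

theorem cutoff_add_le (a b : ℝ) : cutoff a + cutoffSlope a * (b - a) ≤ cutoff b := by
  have hi : ∀ x y, IntervalIntegrable cutoffSlope volume x y := fun x y =>
    continuous_cutoffSlope.intervalIntegrable _ _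
  have h : cutoff b = cutoff a + ∫ r in a..b, cutoffSlope r :=
    (intervalIntegral.integral_add_adjacent_intervals (hi 0 a) (hi a b)).symm
  rw [h]
  refine add_le_add_right ?_ _
  rcases le_total a b with hab | hab
  · have := intervalIntegral.integral_mono_on hab (intervalIntegrable_const (c := cutoffSlope a))
      (hi a b) fun x hx => monotone_cutoffSlope hx.1
    rw [intervalIntegral.integral_const, smul_eq_mul] at this
    linarith
  · have := intervalIntegral.integral_mono_on hab (hi b a)
      (intervalIntegrable_const (c := cutoffSlope a)) fun x hx => monotone_cutoffSlope hx.2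
    rw [intervalIntegral.integral_const, smul_eq_mul] at this
    rw [intervalIntegral.integral_symm]
    linarith

theorem cutoff_zero : cutoff 0 = 0 := intervalIntegral.integral_same

theorem cutoff_nonneg (t : ℝ) : 0 ≤ cutoff t := by
  have := cutoff_add_le 0 t
  rwa [cutoffSlope_eq_zero (by simp), cutoff_zero, zero_mul, zero_add] at this

theorem cutoff_eq_zero {t : ℝ} (h : |t| ≤ 1) : cutoff t = 0 := by
  refine le_antisymm ?_ (cutoff_nonneg t)
  have := cutoff_add_le t 0
  rwa [cutoffSlope_eq_zero h, zero_mul, add_zero, cutoff_zero] at this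

theorem cutoff_pos {t : ℝ} (h : 1 < t) : 0 < cutoff t := by
  have h₁ := cutoff_add_le ((1 + t) / 2) t
  have h₂ := cutoff_nonneg ((1 + t) / 2)
  have h₃ : 0 < cutoffSlope ((1 + t) / 2) := cutoffSlope_pos (by linarith)
  have : 0 < cutoffSlope ((1 + t) / 2) * (t - (1 + t) / 2) := mul_pos h₃ (by linarith)
  linarith

end Cutoff

section Potential

variable {ι : Type*} [Fintype ι]

/-- The linear functional `w ↦ w ⬝ᵥ y`. -/
def dotCLM (y : ι → ℝ) : (ι → ℝ) →L[ℝ] ℝ := ∑ i, y i • ContinuousLinearMap.proj i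

theorem dotCLM_apply (y w : ι → ℝ) : dotCLM y w = w ⬝ᵥ y := by
  simp [dotCLM, dotProduct, mul_comm]

theorem continuous_dotCLM : Continuous (dotCLM (ι := ι)) := by
  unfold dotCLM
  fun_prop

/-- A smooth convex function measuring by how much `x` violates the constraints in `Q`. -/
def potential (Q : Set (ι → ℝ)) (x : ι → ℝ) : ℝ := ∫ y in Q, cutoff (x ⬝ᵥ y)

/-- The gradient of `potential Q`. -/
def potentialGrad (Q : Set (ι → ℝ)) (x : ι → ℝ) : ι → ℝ := ∫ y in Q, cutoffSlope (x ⬝ᵥ y) • y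

theorem continuous_cutoffSlope_dotProduct_smul (x : ι → ℝ) :
    Continuous fun y : ι → ℝ => cutoffSlope (x ⬝ᵥ y) • y := by
  have := continuous_cutoffSlope
  fun_prop

theorem integrableOn_potential {Q : Set (ι → ℝ)} (hQ : IsCompact Q) (x : ι → ℝ) :
    IntegrableOn (fun y => cutoff (x ⬝ᵥ y)) Q := by
  have := continuous_cutoff
  exact ContinuousOn.integrableOn_compact hQ (Continuous.continuousOn (by fun_prop))

theorem integrableOn_potentialGrad {Q : Set (ι → ℝ)} (hQ : IsCompact Q) (x : ι → ℝ) :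
    IntegrableOn (fun y => cutoffSlope (x ⬝ᵥ y) • y) Q :=
  (continuous_cutoffSlope_dotProduct_smul x).continuousOn.integrableOn_compact hQ

theorem potential_add_le {Q : Set (ι → ℝ)} (hQ : IsCompact Q) (x z : ι → ℝ) :
    potential Q x + (z - x) ⬝ᵥ potentialGrad Q x ≤ potential Q z := by
  have h : (z - x) ⬝ᵥ potentialGrad Q x = ∫ y in Q, (z - x) ⬝ᵥ (cutoffSlope (x ⬝ᵥ y) • y) := by
    rw [dotProduct_comm, ← dotCLM_apply, potentialGrad,
      ← ContinuousLinearMap.integral_comp_comm _ (integrableOn_potentialGrad hQ x)]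
    simp only [dotCLM_apply, dotProduct_comm (z - x)]
  have hi : IntegrableOn (fun y => (z - x) ⬝ᵥ (cutoffSlope (x ⬝ᵥ y) • y)) Q := by
    have := continuous_cutoffSlope_dotProduct_smul x
    exact ContinuousOn.integrableOn_compact hQ (Continuous.continuousOn (by fun_prop))
  rw [h, potential, ← integral_add (integrableOn_potential hQ x) hi]
  refine setIntegral_mono ((integrableOn_potential hQ x).add hi) (integrableOn_potential hQ z)
    fun y => ?_
  have := cutoff_add_le (x ⬝ᵥ y) (z ⬝ᵥ y)
  simp only [dotProduct_smul, sub_dotProduct, smul_eq_mul]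
  linarith

theorem norm_potentialGrad_le {Q : Set (ι → ℝ)} (hQ : IsCompact Q) (x : ι → ℝ) :
    ‖potentialGrad Q x‖ ≤ ∫ y in Q, ‖y‖ := by
  refine norm_integral_le_of_norm_le (continuous_norm.continuousOn.integrableOn_compact hQ)
    (.of_forall fun y => ?_)
  rw [norm_smul]
  calc _ ≤ 1 * ‖y‖ := mul_le_mul_of_nonneg_right (norm_cutoffSlope_le _) (norm_nonneg _)
    _ = _ := one_mul _

theorem contDiff_potentialGrad {Q : Set (ι → ℝ)} (hQ : IsCompact Q) :
    ContDiff ℝ 1 (potentialGrad Q) ∧ ∃ C, LipschitzWith C (potentialGrad Q) := by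
  obtain ⟨C, hC⟩ := exists_norm_deriv_cutoffSlope_le
  let F' : (ι → ℝ) → (ι → ℝ) → ((ι → ℝ) →L[ℝ] (ι → ℝ)) := fun x y =>
    deriv cutoffSlope (x ⬝ᵥ y) • (dotCLM y).smulRight y
  have cd := contDiff_cutoffSlope.continuous_deriv_one
  have cs : Continuous fun y : ι → ℝ => (dotCLM y).smulRight y := by
    have := continuous_dotCLM (ι := ι)
    fun_prop
  have hF'y : ∀ x, Continuous (F' x) := fun x => by
    simp only [F']
    fun_prop
  have hF'x : ∀ y, Continuous fun x => F' x y := fun y => by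
    simp only [F']
    fun_prop
  have hb : IntegrableOn (fun y : ι → ℝ => C * ‖(dotCLM y).smulRight y‖) Q :=
    ContinuousOn.integrableOn_compact hQ (Continuous.continuousOn (by fun_prop))
  have hbound : ∀ x y, ‖F' x y‖ ≤ C * ‖(dotCLM y).smulRight y‖ := fun x y => by
    rw [norm_smul]
    exact mul_le_mul_of_nonneg_right (hC _) (norm_nonneg _)
  have hd : ∀ x, HasFDerivAt (potentialGrad Q) (∫ y in Q, F' x y) x := by
    intro x
    refine hasFDerivAt_integral_of_dominated_of_fderiv_le (s := Set.univ) Filter.univ_mem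
      (.of_forall fun z => (continuous_cutoffSlope_dotProduct_smul z).aestronglyMeasurable)
      (integrableOn_potentialGrad hQ x) (hF'y x).aestronglyMeasurable
      (.of_forall fun y z _ => hbound z y) hb (.of_forall fun y z _ => ?_)
    have h₁ : HasFDerivAt (fun z : ι → ℝ => z ⬝ᵥ y) (dotCLM y) z := by
      rw [show (fun z => z ⬝ᵥ y) = dotCLM y from funext fun z => (dotCLM_apply y z).symm]
      exact (dotCLM y).hasFDerivAt
    have h₂ := (contDiff_cutoffSlope.differentiable one_ne_zero (z ⬝ᵥ y)).hasDerivAt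
    refine ((h₂.comp_hasFDerivAt z h₁).smul_const y).congr_fderiv ?_
    ext w i
    simp [F', mul_assoc]
  have hfd : fderiv ℝ (potentialGrad Q) = fun x => ∫ y in Q, F' x y := by
    ext1 x
    exact (hd x).fderiv
  have hcont : Continuous fun x => ∫ y in Q, F' x y :=
    continuous_of_dominated (fun x => (hF'y x).aestronglyMeasurable)
      (fun x => .of_forall fun y => hbound x y) hb (.of_forall hF'x)
  refine ⟨contDiff_one_iff_fderiv.2 ⟨fun x => (hd x).differentiableAt, hfd ▸ hcont⟩,
    (∫ y in Q, C * ‖(dotCLM y).smulRight y‖).toNNReal,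
    lipschitzWith_of_nnnorm_fderiv_le (𝕜 := ℝ) (fun x => (hd x).differentiableAt) fun x => ?_⟩
  rw [hfd, ← NNReal.coe_le_coe, coe_nnnorm]
  exact (norm_integral_le_of_norm_le hb (.of_forall fun y => hbound x y)).trans
    (Real.le_coe_toNNReal _)

theorem continuous_potential {Q : Set (ι → ℝ)} (hQ : IsCompact Q) : Continuous (potential Q) := by
  have := continuous_cutoff
  exact continuous_parametric_integral_of_continuous (f := fun x y : ι → ℝ => cutoff (x ⬝ᵥ y))
    (by fun_prop) hQ

theorem potential_nonneg (Q : Set (ι → ℝ)) (x : ι → ℝ) : 0 ≤ potential Q x :=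
  integral_nonneg fun _ => cutoff_nonneg _

theorem potential_eq_zero {Q : Set (ι → ℝ)} (hQ : IsCompact Q) {x : ι → ℝ}
    (h : ∀ y ∈ Q, |x ⬝ᵥ y| ≤ 1) :
    potential Q x = 0 := by
  rw [potential, setIntegral_congr_fun hQ.measurableSet fun y hy => cutoff_eq_zero (h y hy)]
  simp

theorem potential_pos {Q : Set (ι → ℝ)} (hQ : IsCompact Q) {x y : ι → ℝ}
    (hy : y ∈ interior Q) (h : 1 < x ⬝ᵥ y) : 0 < potential Q x := by
  rw [potential, setIntegral_pos_iff_support_of_nonneg_ae (.of_forall fun _ => cutoff_nonneg _)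
    (integrableOn_potential hQ x)]
  have hopen : IsOpen ({y | 1 < x ⬝ᵥ y} ∩ interior Q) :=
    (isOpen_lt continuous_const (by fun_prop)).inter isOpen_interior
  refine (hopen.measure_pos volume ⟨y, h, hy⟩).trans_le (measure_mono fun z hz => ?_)
  exact ⟨(cutoff_pos hz.1).ne', interior_subset hz.2⟩

end Potential

section Gauge

theorem gauge_smul_of_symmetric {V : Type*} [AddCommGroup V] [Module ℝ V] {s : Set V}
    (hs : ∀ x ∈ s, -x ∈ s) (r : ℝ) (x : V) : gauge s (r • x) = |r| * gauge s x := by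
  rcases le_total 0 r with hr | hr
  · rw [gauge_smul_of_nonneg hr, abs_of_nonneg hr, smul_eq_mul]
  · rw [← gauge_neg hs, ← neg_smul, gauge_smul_of_nonneg (neg_nonneg.2 hr), abs_of_nonpos hr,
      smul_eq_mul]

theorem lintegral_exp_neg_gauge_le {V : Type*} [NormedAddCommGroup V] [NormedSpace ℝ V]
    [FiniteDimensional ℝ V] [MeasurableSpace V] [BorelSpace V] (μ : Measure V)
    [μ.IsAddHaarMeasure] {Q : Set V} (hc : Convex ℝ Q) (hs : ∀ x ∈ Q, -x ∈ Q)
    (h0 : Q ∈ nhds 0) (hb : Bornology.IsBounded Q) :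
    ∫⁻ x, ENNReal.ofReal (Real.exp (-gauge Q x)) ∂μ ≤
      (Module.finrank ℝ V).factorial * μ Q := by
  have habs : Absorbent ℝ Q := absorbent_nhds_zero h0
  have key := measure_lt_one_eq_integral_div_gamma μ (g := gauge Q) gauge_zero (gauge_neg hs)
    (gauge_add_le hc habs)
    (fun h => (gauge_eq_zero habs (NormedSpace.isVonNBounded_of_isBounded ℝ hb)).1 h)
    (fun r x => (gauge_smul_of_symmetric hs r x).le) one_pos
  simp only [Real.rpow_one, div_one, Real.Gamma_nat_eq_factorial] at key
  have hsub := setOfPred_gauge_lt_one_subset_self hc (mem_of_mem_nhds h0) habs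
  have hpos : 0 < μ {x | gauge Q x < 1} :=
    (isOpen_lt (continuous_gauge hc h0) continuous_const).measure_pos μ ⟨0, by simp [gauge_zero]⟩
  have hInt : Integrable (fun x => Real.exp (-gauge Q x)) μ := by
    by_contra h
    rw [integral_undef h, zero_div, ENNReal.ofReal_zero] at key
    exact hpos.ne' key
  rw [← ofReal_integral_eq_lintegral_ofReal hInt (.of_forall fun _ => (Real.exp_pos _).le)]
  have hf : (0 : ℝ) < (Module.finrank ℝ V).factorial := by positivity
  calc ENNReal.ofReal (∫ x, Real.exp (-gauge Q x) ∂μ)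
      = ENNReal.ofReal ((Module.finrank ℝ V).factorial *
          ((∫ x, Real.exp (-gauge Q x) ∂μ) / (Module.finrank ℝ V).factorial)) := by
        congr 1
        field_simp
    _ = (Module.finrank ℝ V).factorial * μ {x | gauge Q x < 1} := by
        rw [ENNReal.ofReal_mul hf.le, key, ENNReal.ofReal_natCast]
    _ ≤ _ := by gcongr

end Gauge

section DotPolar

variable {ι : Type*} [Fintype ι]

/-- The polar of a set with respect to the dot product. -/
def dotPolar (L : Set (ι → ℝ)) : Set (ι → ℝ) := {y | ∀ x ∈ L, x ⬝ᵥ y ≤ 1}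

theorem convex_dotPolar (L : Set (ι → ℝ)) : Convex ℝ (dotPolar L) := by
  intro y hy z hz a b ha hb hab x hx
  rw [dotProduct_add, dotProduct_smul, dotProduct_smul, smul_eq_mul, smul_eq_mul]
  nlinarith [hy x hx, hz x hx]

theorem isClosed_dotPolar (L : Set (ι → ℝ)) : IsClosed (dotPolar L) := by
  simp only [dotPolar, Set.ofPred_forall]
  exact isClosed_biInter fun x _ => isClosed_le (by fun_prop) continuous_const

theorem neg_mem_dotPolar {L : Set (ι → ℝ)} (hs : ∀ x ∈ L, -x ∈ L) :
    ∀ y ∈ dotPolar L, -y ∈ dotPolar L := by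
  intro y hy x hx
  rw [dotProduct_neg, ← neg_dotProduct]
  exact hy _ (hs x hx)

theorem abs_dotProduct_le_one {L : Set (ι → ℝ)} (hs : ∀ x ∈ L, -x ∈ L) {x y : ι → ℝ}
    (hx : x ∈ L) (hy : y ∈ dotPolar L) : |x ⬝ᵥ y| ≤ 1 := by
  have h := hy _ (hs x hx)
  rw [neg_dotProduct] at h
  exact abs_le.2 ⟨by linarith, hy x hx⟩

theorem dotPolar_mem_nhds {L : Set (ι → ℝ)} (hL : IsCompact L) : dotPolar L ∈ nhds 0 := by
  have : ∀ᶠ y in nhds (0 : ι → ℝ), ∀ x ∈ L, x ⬝ᵥ y < 1 := by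
    refine hL.eventually_forall_of_forall_eventually fun x _ => ?_
    refine Filter.Tendsto.eventually_lt_const one_pos (Continuous.tendsto' (by fun_prop) _ _ ?_)
    simp
  filter_upwards [this] with y hy x hx using (hy x hx).le

theorem isCompact_dotPolar {L : Set (ι → ℝ)} (h0 : L ∈ nhds 0) (hs : ∀ x ∈ L, -x ∈ L) :
    IsCompact (dotPolar L) := by
  classical
  refine Metric.isCompact_of_isClosed_isBounded (isClosed_dotPolar L) ?_
  obtain ⟨r, hr, hball⟩ := Metric.nhds_basis_closedBall.mem_iff.1 h0
  refine (Metric.isBounded_closedBall (x := (0 : ι → ℝ)) (r := r⁻¹)).subset fun y hy => ?_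
  rw [mem_closedBall_zero_iff, pi_norm_le_iff_of_nonneg (by positivity)]
  intro i
  have hx : (Pi.single i r : ι → ℝ) ∈ L := hball (by
    rw [mem_closedBall_zero_iff, Pi.norm_single, Real.norm_of_nonneg hr.le])
  have := abs_dotProduct_le_one hs hx hy
  rw [single_dotProduct, abs_mul, abs_of_pos hr] at this
  rw [Real.norm_eq_abs, ← one_div, le_div_iff₀ hr]
  linarith

theorem exists_mem_interior_dotPolar {L : Set (ι → ℝ)} (hc : Convex ℝ L) (hL : IsCompact L)
    (h0 : (0 : ι → ℝ) ∈ L) {x : ι → ℝ} (hx : x ∉ L) :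
    ∃ y ∈ interior (dotPolar L), 1 < x ⬝ᵥ y := by
  classical
  obtain ⟨f, u, hfL, hfx⟩ := geometric_hahn_banach_closed_point hc hL.isClosed hx
  have hu : 0 < u := by simpa using hfL 0 h0
  have hrep : ∀ w : ι → ℝ, w ⬝ᵥ (fun i => f (Pi.single i 1)) = f w := by
    intro w
    conv_rhs => rw [← Finset.univ_sum_single w, map_sum]
    refine Finset.sum_congr rfl fun i _ => ?_
    rw [← smul_eq_mul, ← map_smul, ← Pi.single_smul, smul_eq_mul, mul_one]
  have hfx0 : 0 < f x := hu.trans hfx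
  refine ⟨u⁻¹ • fun i => f (Pi.single i 1), ?_, ?_⟩
  · rw [mem_interior_iff_mem_nhds]
    have : ∀ᶠ y in nhds (u⁻¹ • fun i => f (Pi.single i 1) : ι → ℝ), ∀ x ∈ L, x ⬝ᵥ y < 1 := by
      refine hL.eventually_forall_of_forall_eventually fun x hx => ?_
      refine (isOpen_lt (by fun_prop) continuous_const).mem_nhds ?_
      simp only [dotProduct_smul, hrep, smul_eq_mul, Set.mem_ofPred_eq]
      rw [inv_mul_lt_iff₀ hu, mul_one]
      exact hfL x hx
    filter_upwards [this] with y hy x hx using (hy x hx).le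
  · rw [dotProduct_smul, hrep, smul_eq_mul, lt_inv_mul_iff₀ hu, mul_one]
    exact hfx

theorem gauge_dotPolar_le {L : Set (ι → ℝ)} (h0 : (0 : ι → ℝ) ∈ L) {b : ι → ℝ} {t : ℝ}
    (h : ∀ z ∈ L, z ⬝ᵥ b ≤ t) : gauge (dotPolar L) b ≤ t := by
  have ht : 0 ≤ t := by simpa using h 0 h0
  refine le_of_forall_pos_le_add fun δ hδ => gauge_le_of_mem (by positivity) ?_
  have hpos : 0 < t + δ := by positivity
  rw [Set.mem_smul_set_iff_inv_smul_mem₀ hpos.ne']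
  intro z hz
  rw [dotProduct_smul, smul_eq_mul, inv_mul_le_iff₀ hpos, mul_one]
  linarith [h z hz]

end DotPolar

section VolumeProduct

variable {ι : Type*} [Fintype ι]

/-- A smooth strictly convex function, close to the indicator of `L` for small `ε` and large `k`. -/
def convexPenalty (L : Set (ι → ℝ)) (ε k : ℝ) (x : ι → ℝ) : ℝ :=
  ε / 2 * (x ⬝ᵥ x) + k * potential (dotPolar L) x

theorem convexPenalty_add_le {L : Set (ι → ℝ)} (hQ : IsCompact (dotPolar L)) {ε k : ℝ}
    (hε : 0 < ε) (hk : 0 ≤ k) (x z : ι → ℝ) :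
    convexPenalty L ε k x +
      (z - x) ⬝ᵥ (ε • (x + (k / ε) • potentialGrad (dotPolar L) x)) ≤ convexPenalty L ε k z := by
  have h := mul_le_mul_of_nonneg_left (potential_add_le hQ x z) hk
  have hsq : 0 ≤ (z - x) ⬝ᵥ (z - x) := by
    simpa [dotProduct] using Finset.sum_nonneg fun i _ => mul_self_nonneg ((z - x) i)
  have e : (z - x) ⬝ᵥ (z - x) = z ⬝ᵥ z - 2 * ((z - x) ⬝ᵥ x) - x ⬝ᵥ x := by
    simp only [sub_dotProduct, dotProduct_sub, dotProduct_comm x z]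
    ring
  rw [e] at hsq
  rw [smul_add, smul_smul, mul_div_cancel₀ _ hε.ne', dotProduct_add, dotProduct_smul,
    dotProduct_smul, smul_eq_mul, smul_eq_mul, convexPenalty, convexPenalty]
  nlinarith

theorem convexPenalty_midpoint_le {L : Set (ι → ℝ)} (hQ : IsCompact (dotPolar L)) {ε k : ℝ}
    (hε : 0 < ε) (hk : 0 ≤ k) (x y : ι → ℝ) :
    convexPenalty L ε k ((2⁻¹ : ℝ) • (x + y)) ≤
      2⁻¹ * (convexPenalty L ε k x + convexPenalty L ε k y) := by
  set m : ι → ℝ := (2⁻¹ : ℝ) • (x + y) with hm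
  have h₁ := convexPenalty_add_le hQ hε hk m x
  have h₂ := convexPenalty_add_le hQ hε hk m y
  have e : y - m = -(x - m) := by
    ext i
    simp [hm]
    ring
  rw [e, neg_dotProduct] at h₂
  linarith

theorem gauge_dotPolar_gradient_le {L : Set (ι → ℝ)} (h0 : L ∈ nhds 0)
    (hs : ∀ x ∈ L, -x ∈ L) {ε k S : ℝ} (hε : 0 < ε)
    (hk : 0 ≤ k) (hS : ∀ z ∈ L, z ⬝ᵥ z / 2 ≤ S) (x : ι → ℝ) :
    gauge (dotPolar L) (ε • (x + (k / ε) • potentialGrad (dotPolar L) x)) ≤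
      x ⬝ᵥ (ε • (x + (k / ε) • potentialGrad (dotPolar L) x)) - convexPenalty L ε k x + ε * S := by
  have hQ := isCompact_dotPolar h0 hs
  refine gauge_dotPolar_le (mem_of_mem_nhds h0) fun z hz => ?_
  have h := convexPenalty_add_le hQ hε hk x z
  have hz0 : convexPenalty L ε k z ≤ ε * S := by
    rw [convexPenalty, potential_eq_zero hQ fun y hy => abs_dotProduct_le_one hs hz hy]
    nlinarith [hS z hz]
  rw [sub_dotProduct] at h
  linarith

theorem pi_pow_le_lintegral_convexPenalty {L : Set (ι → ℝ)} (hL : IsCompact L)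
    (h0 : L ∈ nhds 0) (hs : ∀ x ∈ L, -x ∈ L) {ε k S : ℝ} (hε : 0 < ε)
    (hk : 0 ≤ k) (hS : ∀ z ∈ L, z ⬝ᵥ z / 2 ≤ S) :
    ENNReal.ofReal (Real.pi ^ Fintype.card ι) ≤
      (∫⁻ x, ENNReal.ofReal (Real.exp (-convexPenalty L ε k x))) *
        (ENNReal.ofReal (Real.exp (ε * S)) *
          ∫⁻ x, ENNReal.ofReal (Real.exp (-gauge (dotPolar L) x))) := by
  classical
  have hQ := isCompact_dotPolar h0 hs
  have hQ0 := dotPolar_mem_nhds hL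
  have hQc := convex_dotPolar L
  have hQs := neg_mem_dotPolar hs
  obtain ⟨hcd, C, hC⟩ := contDiff_potentialGrad hQ
  have hcont : Continuous (convexPenalty L ε k) := by
    have := continuous_potential hQ
    unfold convexPenalty
    fun_prop
  have hmono : ∀ x y, 0 ≤ (x - y) ⬝ᵥ (((k / ε) • potentialGrad (dotPolar L)) x -
      ((k / ε) • potentialGrad (dotPolar L)) y) := by
    intro x y
    have h₁ := potential_add_le hQ x y
    have h₂ := potential_add_le hQ y x
    rw [Pi.smul_apply, Pi.smul_apply, ← smul_sub, dotProduct_smul, smul_eq_mul]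
    refine mul_nonneg (by positivity) ?_
    rw [← neg_sub x y, neg_dotProduct] at h₁
    rw [dotProduct_sub]
    linarith
  have hlip : LipschitzWith (‖k / ε‖₊ * C) ((k / ε) • potentialGrad (dotPolar L)) :=
    (lipschitzWith_smul (k / ε)).comp hC
  have key := pi_pow_le_lintegral_mul_lintegral (hcd.const_smul (k / ε))
    (M := ‖k / ε‖ * ∫ y in dotPolar L, ‖y‖)
    (fun x => by
      rw [norm_smul]
      exact mul_le_mul_of_nonneg_left (norm_potentialGrad_le hQ x) (norm_nonneg _))
    hlip hε hmono (Φ := convexPenalty L ε k)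
    (Ψ := fun b => gauge (dotPolar L) b - ε * S) hcont.measurable
    ((continuous_gauge hQc hQ0).sub continuous_const).measurable ?_
  · refine key.trans_eq ?_
    congr 1
    rw [← lintegral_const_mul' _ _ ENNReal.ofReal_ne_top]
    refine lintegral_congr fun x => ?_
    rw [← ENNReal.ofReal_mul (Real.exp_pos _).le, ← Real.exp_add]
    congr 2
    ring
  · intro x y
    have g₁ := gauge_dotPolar_gradient_le h0 hs hε hk hS x
    have g₂ := gauge_dotPolar_gradient_le h0 hs hε hk hS y
    have g₃ := convexPenalty_midpoint_le hQ hε hk x y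
    set bx := x + (k / ε) • potentialGrad (dotPolar L) x with hbx
    set b' := y + (k / ε) • potentialGrad (dotPolar L) y with hby
    have e : (ε / 2) • (bx - b') = (2⁻¹ : ℝ) • (ε • bx + -(ε • b')) := by
      rw [← sub_eq_add_neg, ← smul_sub, smul_smul]
      congr 1
      ring
    have g₄ : gauge (dotPolar L) ((ε / 2) • (bx - b')) ≤
        2⁻¹ * (gauge (dotPolar L) (ε • bx) + gauge (dotPolar L) (ε • b')) := by
      rw [e, gauge_smul_of_nonneg (by norm_num), smul_eq_mul]
      refine mul_le_mul_of_nonneg_left ?_ (by norm_num)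
      refine (gauge_add_le hQc (absorbent_nhds_zero hQ0) _ _).trans_eq ?_
      rw [gauge_neg hQs]
    simp only [dotProduct_smul, smul_eq_mul] at g₁ g₂
    change convexPenalty L ε k ((2⁻¹ : ℝ) • (x + y)) +
      (gauge (dotPolar L) ((ε / 2) • (bx - b')) - ε * S) ≤ ε / 2 * (x ⬝ᵥ bx + y ⬝ᵥ b')
    linarith

theorem tendsto_lintegral_convexPenalty {L : Set (ι → ℝ)} (hc : Convex ℝ L) (hL : IsCompact L)
    (h0 : L ∈ nhds 0) (hs : ∀ x ∈ L, -x ∈ L) {ε : ℝ} (hε : 0 < ε) :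
    Filter.Tendsto (fun k : ℕ => ∫⁻ x, ENNReal.ofReal (Real.exp (-convexPenalty L ε k x)))
      Filter.atTop
      (nhds (∫⁻ x, L.indicator (fun x => ENNReal.ofReal (Real.exp (-(ε / 2 * (x ⬝ᵥ x))))) x)) := by
  have hQ := isCompact_dotPolar h0 hs
  have hcont : ∀ k : ℝ, Continuous (convexPenalty L ε k) := by
    intro k
    have := continuous_potential hQ
    unfold convexPenalty
    fun_prop
  refine tendsto_lintegral_of_dominated_convergence
    (fun x : ι → ℝ => ENNReal.ofReal (Real.exp (-(ε / 2) * ∑ i, x i ^ 2)))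
    (fun k => ?_) (fun k => .of_forall fun x => ?_) ?_ (.of_forall fun x => ?_)
  · exact ENNReal.measurable_ofReal.comp
      (Real.measurable_exp.comp (hcont k).measurable.neg)
  · refine ENNReal.ofReal_le_ofReal (Real.exp_le_exp.2 ?_)
    have := mul_nonneg (Nat.cast_nonneg (α := ℝ) k) (potential_nonneg (dotPolar L) x)
    simp only [convexPenalty, dotProduct, ← pow_two]
    linarith
  · exact (integrable_exp_neg_mul_sum_sq (half_pos hε)).lintegral_lt_top.ne
  · by_cases hx : x ∈ L
    · rw [Set.indicator_of_mem hx]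
      have : ∀ k : ℕ, convexPenalty L ε k x = ε / 2 * (x ⬝ᵥ x) := fun k => by
        rw [convexPenalty, potential_eq_zero hQ fun y hy => abs_dotProduct_le_one hs hx hy,
          mul_zero, add_zero]
      simp only [this]
      exact tendsto_const_nhds
    · rw [Set.indicator_of_notMem hx, ← ENNReal.ofReal_zero]
      refine ENNReal.tendsto_ofReal (Real.tendsto_exp_atBot.comp
        (Filter.tendsto_neg_atTop_atBot.comp ?_))
      obtain ⟨y, hy, hxy⟩ := exists_mem_interior_dotPolar hc hL (mem_of_mem_nhds h0) hx
      exact Filter.tendsto_atTop_add_const_left _ _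
        (tendsto_natCast_atTop_atTop.atTop_mul_const (potential_pos hQ hy hxy))

/-- Kuperberg's volume product bound `π ^ n / n! ≤ vol L * vol L°` for symmetric convex bodies. -/
theorem pi_pow_le_volume_mul_volume_dotPolar {L : Set (ι → ℝ)} (hc : Convex ℝ L)
    (hL : IsCompact L) (h0 : L ∈ nhds 0) (hs : ∀ x ∈ L, -x ∈ L) :
    ENNReal.ofReal (Real.pi ^ Fintype.card ι) ≤
      volume L * ((Fintype.card ι).factorial * volume (dotPolar L)) := by
  have hQ := isCompact_dotPolar h0 hs
  have hQ0 := dotPolar_mem_nhds hL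
  obtain ⟨S, hS⟩ : ∃ S, ∀ z ∈ L, z ⬝ᵥ z / 2 ≤ S := by
    obtain ⟨S, hS⟩ := hL.bddAbove_image (f := fun z : ι → ℝ => z ⬝ᵥ z / 2)
      (Continuous.continuousOn (by fun_prop))
    exact ⟨S, fun z hz => hS ⟨z, hz, rfl⟩⟩
  set B := ∫⁻ x, ENNReal.ofReal (Real.exp (-gauge (dotPolar L) x)) with hB
  have hBle : B ≤ (Fintype.card ι).factorial * volume (dotPolar L) := by
    have := lintegral_exp_neg_gauge_le volume (convex_dotPolar L) (neg_mem_dotPolar hs) hQ0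
      hQ.isBounded
    rwa [Module.finrank_fintype_fun_eq_card] at this
  have hBtop : B ≠ ⊤ := ne_top_of_le_ne_top
    (ENNReal.mul_ne_top (ENNReal.natCast_ne_top _) hQ.measure_lt_top.ne) hBle
  have step : ∀ ε : ℝ, 0 < ε → ENNReal.ofReal (Real.pi ^ Fintype.card ι) ≤
      volume L * (ENNReal.ofReal (Real.exp (ε * S)) * B) := by
    intro ε hε
    have hlim := ENNReal.Tendsto.mul_const (b := ENNReal.ofReal (Real.exp (ε * S)) * B)
      (tendsto_lintegral_convexPenalty hc hL h0 hs hε)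
      (Or.inr (ENNReal.mul_ne_top ENNReal.ofReal_ne_top hBtop))
    refine (ge_of_tendsto' hlim fun k =>
      pi_pow_le_lintegral_convexPenalty hL h0 hs hε (Nat.cast_nonneg k) hS).trans ?_
    gcongr
    rw [lintegral_indicator hL.measurableSet]
    calc _ ≤ ∫⁻ x in L, 1 := by
          refine lintegral_mono fun x => ENNReal.ofReal_le_one.2 (Real.exp_le_one_iff.2 ?_)
          have : 0 ≤ x ⬝ᵥ x := by
            simpa [dotProduct] using Finset.sum_nonneg fun i _ => mul_self_nonneg (x i)
          have := mul_nonneg (half_pos hε).le this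
          linarith
      _ = volume L := by simp
  have hlim : Filter.Tendsto (fun ε : ℝ => volume L * (ENNReal.ofReal (Real.exp (ε * S)) * B))
      (nhdsWithin 0 (Set.Ioi 0)) (nhds (volume L * (1 * B))) := by
    refine ENNReal.Tendsto.const_mul (ENNReal.Tendsto.mul_const ?_ (Or.inr hBtop))
      (Or.inr hL.measure_lt_top.ne)
    rw [← ENNReal.ofReal_one]
    refine ENNReal.tendsto_ofReal (tendsto_nhdsWithin_of_tendsto_nhds ?_)
    exact Continuous.tendsto' (by fun_prop) _ _ (by simp)
  have := ge_of_tendsto hlim (eventually_nhdsWithin_of_forall fun ε hε => step ε hε)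
  rw [one_mul] at this
  exact this.trans (by gcongr)

end VolumeProduct

section RogersShephard

theorem lintegral_Ioo_beta (n : ℕ) (hn : 0 < n) :
    (Nat.choose (2 * n) n : ENNReal) * (n * ∫⁻ t in Set.Ioo (0 : ℝ) 1,
      ENNReal.ofReal ((1 - t) ^ n) * ENNReal.ofReal (t ^ ((n : ℝ) - 1))) = 1 := by
  have hn' : (0 : ℝ) < n := by exact_mod_cast hn
  have h := ProbabilityTheory.lintegral_betaPDF_eq_one hn' (add_pos hn' one_pos)
  rw [ProbabilityTheory.lintegral_betaPDF] at h
  have hβ : 1 / ProbabilityTheory.beta n (n + 1) = Nat.choose (2 * n) n * n := by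
    obtain ⟨m, rfl⟩ : ∃ m, n = m + 1 := ⟨n - 1, by omega⟩
    have e : ((m + 1 : ℕ) : ℝ) + (((m + 1 : ℕ) : ℝ) + 1) = ((2 * (m + 1) : ℕ) : ℝ) + 1 := by
      push_cast; ring
    rw [ProbabilityTheory.beta, e, Real.Gamma_nat_eq_factorial, Real.Gamma_nat_eq_factorial,
      Nat.cast_add_one m, Real.Gamma_nat_eq_factorial,
      Nat.cast_choose ℝ (by omega : m + 1 ≤ 2 * (m + 1)),
      show 2 * (m + 1) - (m + 1) = m + 1 by omega, Nat.factorial_succ m]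
    have := Nat.factorial_ne_zero m
    push_cast
    field_simp
  rw [← mul_assoc, ← lintegral_const_mul' _ _ (by finiteness), ← h]
  refine setLIntegral_congr_fun measurableSet_Ioo fun t ht => ?_
  have h1 : (0 : ℝ) ≤ 1 - t := by linarith [ht.2]
  rw [hβ, add_sub_cancel_right, Real.rpow_natCast, ENNReal.ofReal_mul (by positivity [ht.1]),
    ENNReal.ofReal_mul (by positivity), ENNReal.ofReal_mul (by positivity),
    ENNReal.ofReal_natCast, ENNReal.ofReal_natCast]
  ring

theorem sub_self_mem_nhds_zero {V : Type*} [NormedAddCommGroup V] {K : Set V}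
    (h : (interior K).Nonempty) : K - K ∈ nhds 0 := by
  obtain ⟨x, hx⟩ := h
  have : interior K - interior K ∈ nhds (0 : V) :=
    (isOpen_interior.sub_right).mem_nhds ⟨x, hx, x, hx, sub_self x⟩
  exact Filter.mem_of_superset this (Set.sub_subset_sub interior_subset interior_subset)

variable {V : Type*} [NormedAddCommGroup V] [NormedSpace ℝ V] [FiniteDimensional ℝ V]
  [MeasurableSpace V] [BorelSpace V] (μ : Measure V) [μ.IsAddHaarMeasure]

theorem measure_le_choose_mul_lintegral_gauge {D : Set V} (hc : Convex ℝ D) (h0 : D ∈ nhds 0) :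
    μ D ≤ Nat.choose (2 * Module.finrank ℝ V) (Module.finrank ℝ V) *
      ∫⁻ x, ENNReal.ofReal (max (1 - gauge D x) 0 ^ Module.finrank ℝ V) ∂μ := by
  set n := Module.finrank ℝ V with hn
  rcases Nat.eq_zero_or_pos n with h | h
  · simpa [h] using measure_mono (Set.subset_univ D)
  have hn' : (0 : ℝ) < n := by exact_mod_cast h
  have key := lintegral_rpow_eq_lintegral_meas_le_mul μ (f := fun x => max (1 - gauge D x) 0)
    (.of_forall fun x => le_max_right _ _)
    (((continuous_const.sub (continuous_gauge hc h0)).max continuous_const).aemeasurable) hn'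
  simp only [Real.rpow_natCast] at key
  rw [key, ENNReal.ofReal_natCast]
  have hle : (∫⁻ t in Set.Ioo (0 : ℝ) 1,
      ENNReal.ofReal ((1 - t) ^ n) * ENNReal.ofReal (t ^ ((n : ℝ) - 1))) * μ D ≤
      ∫⁻ t in Set.Ioi 0, μ {a | t ≤ max (1 - gauge D a) 0} *
        ENNReal.ofReal (t ^ ((n : ℝ) - 1)) := by
    rw [← lintegral_mul_const _ (by fun_prop)]
    refine (setLIntegral_mono' measurableSet_Ioo fun t ht => ?_).trans
      (lintegral_mono_set Set.Ioo_subset_Ioi_self)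
    have h1 : (0 : ℝ) ≤ 1 - t := by linarith [ht.2]
    rw [mul_right_comm]
    gcongr
    rw [← abs_of_nonneg (pow_nonneg h1 n), hn, ← Measure.addHaar_smul]
    refine measure_mono fun x hx => le_max_of_le_left (b := 1 - gauge D x) ?_
    linarith [gauge_le_of_mem h1 hx]
  calc μ D = 1 * μ D := (one_mul _).symm
    _ = _ := by rw [← lintegral_Ioo_beta n h]
    _ ≤ _ := by
      rw [mul_assoc, mul_assoc]
      gcongr

theorem lintegral_measure_inter_vadd {K : Set V} (hK : MeasurableSet K) :
    ∫⁻ x, μ (K ∩ {y | y - x ∈ K}) ∂μ = μ K * μ K := by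
  have hm : Measurable fun p : V × V =>
      (K ∩ {y | y - p.1 ∈ K}).indicator (1 : V → ENNReal) p.2 := by
    have : MeasurableSet {p : V × V | p.2 ∈ K ∧ p.2 - p.1 ∈ K} :=
      (hK.preimage measurable_snd).inter (hK.preimage (measurable_snd.sub measurable_fst))
    exact (measurable_one (α := ENNReal)).indicator this
  have hK' : ∀ x : V, MeasurableSet (K ∩ {y | y - x ∈ K}) := fun x =>
    hK.inter (hK.preimage (measurable_id.sub_const x))
  calc ∫⁻ x, μ (K ∩ {y | y - x ∈ K}) ∂μ
      = ∫⁻ x, ∫⁻ y, (K ∩ {y | y - x ∈ K}).indicator 1 y ∂μ ∂μ := by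
        simp only [lintegral_indicator_one (hK' _)]
    _ = ∫⁻ y, ∫⁻ x, (K ∩ {y | y - x ∈ K}).indicator 1 y ∂μ ∂μ :=
        lintegral_lintegral_swap hm.aemeasurable
    _ = ∫⁻ y, K.indicator (fun _ => μ K) y ∂μ := by
        refine lintegral_congr fun y => ?_
        by_cases hy : y ∈ K
        · rw [Set.indicator_of_mem hy]
          calc _ = ∫⁻ x, K.indicator 1 (y - x) ∂μ := lintegral_congr fun x => by
                by_cases h : y - x ∈ K
                · rw [Set.indicator_of_mem h, Set.indicator_of_mem (show y ∈ K ∩ {y | y - x ∈ K} from ⟨hy, h⟩)]; rfl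
                · rw [Set.indicator_of_notMem h, Set.indicator_of_notMem
                    fun h' : y ∈ K ∩ {y | y - x ∈ K} => h h'.2]
            _ = ∫⁻ x, K.indicator 1 x ∂μ := lintegral_sub_left_eq_self _ y
            _ = _ := lintegral_indicator_one hK
        · simp [hy]
    _ = _ := by rw [lintegral_indicator_const hK]

theorem ofReal_pow_mul_measure_le_measure_inter_vadd {K : Set V} (hc : Convex ℝ K)
    (hK : IsCompact K) (hne : K.Nonempty) (h0 : K - K ∈ nhds 0) (x : V) :
    ENNReal.ofReal (max (1 - gauge (K - K) x) 0 ^ Module.finrank ℝ V) * μ K ≤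
      μ (K ∩ {y | y - x ∈ K}) := by
  set r := gauge (K - K) x with hr
  have hr0 : 0 ≤ r := gauge_nonneg x
  have hDc : Convex ℝ (K - K) := hc.sub hc
  have habs : Absorbent ℝ (K - K) := absorbent_nhds_zero h0
  have hD : IsCompact (K - K) := by
    rw [sub_eq_add_neg]
    exact hK.add hK.neg
  rcases le_or_gt 1 r with h1 | h1
  · rw [max_eq_right (by linarith)]
    rcases Nat.eq_zero_or_pos (Module.finrank ℝ V) with h | h
    · have : Subsingleton V := Module.finrank_zero_iff.1 h
      obtain ⟨k, hk⟩ := hne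
      have : K ⊆ K ∩ {y | y - x ∈ K} := fun y hy =>
        ⟨hy, by rwa [Set.mem_ofPred_eq, Subsingleton.elim (y - x) y]⟩
      simpa [h] using measure_mono this
    · simp [h.ne']
  rw [max_eq_left (by linarith)]
  obtain ⟨a, ha, b, hb, hx⟩ : ∃ a ∈ K, ∃ b ∈ K, x = r • (a - b) := by
    rcases hr0.eq_or_lt with h | h
    · obtain ⟨k, hk⟩ := hne
      refine ⟨k, hk, k, hk, ?_⟩
      rw [sub_self, smul_zero]
      exact (gauge_eq_zero habs (NormedSpace.isVonNBounded_of_isBounded ℝ hD.isBounded)).1 h.symm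
    · have : r⁻¹ • x ∈ closure (K - K) := by
        rw [← gauge_le_one_iff_mem_closure hDc h0, gauge_smul_of_nonneg (inv_nonneg.2 hr0),
          smul_eq_mul, ← hr, inv_mul_cancel₀ h.ne']
      rw [hD.isClosed.closure_eq] at this
      obtain ⟨a, ha, b, hb, hab⟩ := this
      refine ⟨a, ha, b, hb, ?_⟩
      rw [show a - b = r⁻¹ • x from hab, smul_inv_smul₀ h.ne']
  have hnn : (0 : ℝ) ≤ 1 - r := by linarith
  rw [← abs_of_nonneg (pow_nonneg hnn _), ← Measure.addHaar_smul,
    ← measure_preimage_add μ (-(r • a))]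
  refine measure_mono ?_
  rintro y ⟨k, hk, hy⟩
  have hy' : y = (1 - r) • k + r • a := by
    rw [show (1 - r) • k = -(r • a) + y from hy]; abel
  refine ⟨hy' ▸ hc hk ha hnn hr0 (by ring), ?_⟩
  have : y - x = (1 - r) • k + r • b := by
    rw [hy', hx, smul_sub]; abel
  rw [Set.mem_ofPred_eq, this]
  exact hc hk hb hnn hr0 (by ring)

/-- The Rogers–Shephard inequality. -/
theorem measure_sub_self_le_choose_mul {K : Set V} (hc : Convex ℝ K) (hK : IsCompact K)
    (hi : (interior K).Nonempty) :
    μ (K - K) ≤ Nat.choose (2 * Module.finrank ℝ V) (Module.finrank ℝ V) * μ K := by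
  have h0 := sub_self_mem_nhds_zero hi
  have hpos : μ K ≠ 0 := (Measure.measure_pos_of_nonempty_interior μ hi).ne'
  have htop : μ K ≠ ⊤ := hK.measure_lt_top.ne
  refine (measure_le_choose_mul_lintegral_gauge μ (hc.sub hc) h0).trans ?_
  gcongr
  rw [← ENNReal.mul_le_mul_iff_left hpos htop, ← lintegral_mul_const' _ _ htop,
    ← lintegral_measure_inter_vadd μ hK.measurableSet]
  exact lintegral_mono fun x => ofReal_pow_mul_measure_le_measure_inter_vadd μ hc hK
    (hi.mono interior_subset) h0 x

end RogersShephard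

section LatticeReduction

variable {ι : Type*}

/-- The reduction of `S` modulo integer translations in the coordinates from `J`, realised in the
strip where these coordinates lie in `[0, 1)`. -/
def latticeReduction (J : Finset ι) (S : Set (ι → ℝ)) : Set (ι → ℝ) :=
  {x | (∀ j ∈ J, x j ∈ Set.Ico (0 : ℝ) 1) ∧
    ∃ z : ι → ℤ, (∀ j ∉ J, z j = 0) ∧ (fun j => x j + z j) ∈ S}

theorem measurableSet_latticeReduction [Finite ι] (J : Finset ι) {S : Set (ι → ℝ)}
    (hS : MeasurableSet S) : MeasurableSet (latticeReduction J S) := by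
  have : latticeReduction J S = (⋂ j ∈ J, {x | x j ∈ Set.Ico (0 : ℝ) 1}) ∩
      ⋃ z ∈ {z : ι → ℤ | ∀ j ∉ J, z j = 0}, {x | (fun j => x j + (z j : ℝ)) ∈ S} := by
    ext x
    simp [latticeReduction]
  rw [this]
  refine (Finset.measurableSet_biInter J fun j _ =>
    measurableSet_Ico.preimage (measurable_pi_apply j)).inter
    (MeasurableSet.biUnion (Set.to_countable _) fun z _ => ?_)
  exact hS.preimage (measurable_pi_lambda _ fun j => (measurable_pi_apply j).add_const _)

theorem latticeReduction_empty (S : Set (ι → ℝ)) : latticeReduction ∅ S = S := by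
  ext x
  simp only [latticeReduction, Finset.notMem_empty, IsEmpty.forall_iff, implies_true, true_and,
    not_false_eq_true, forall_const, Set.mem_ofPred_eq]
  constructor
  · rintro ⟨z, hz, h⟩
    simpa [hz] using h
  · exact fun h => ⟨0, by simp, by simpa using h⟩

theorem volume_latticeReduction_univ_le_one [Fintype ι] (S : Set (ι → ℝ)) :
    volume (latticeReduction Finset.univ S) ≤ 1 := by
  calc volume (latticeReduction Finset.univ S)
      ≤ volume (Set.univ.pi fun _ : ι => Set.Ico (0 : ℝ) 1) :=
        measure_mono fun x hx j _ => hx.1 j (Finset.mem_univ j)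
    _ = 1 := by simp [Real.volume_pi_Ico]

/-- If no two points of `S` are identified by translations that move the coordinate `i`, reducing
modulo that coordinate as well does not decrease the volume. -/
theorem volume_latticeReduction_le_insert [Fintype ι] [DecidableEq ι] {J : Finset ι} {i : ι}
    (hi : i ∉ J) {S : Set (ι → ℝ)} (hS : MeasurableSet S)
    (hinj : ∀ x ∈ S, ∀ y ∈ S, ∀ z : ι → ℤ, (∀ j, x j - y j = z j) → z i = 0) :
    volume (latticeReduction J S) ≤ volume (latticeReduction (insert i J) S) := by
  set U := latticeReduction J S with hU
  have hUm : MeasurableSet U := measurableSet_latticeReduction J hS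
  set T : ℤ → Set (ι → ℝ) := fun k =>
    {x | x i ∈ Set.Ico (0 : ℝ) 1 ∧ x + Pi.single i (k : ℝ) ∈ U} with hT
  have hTm : ∀ k, MeasurableSet (T k) := fun k =>
    (measurableSet_Ico.preimage (measurable_pi_apply i)).inter
      (hUm.preimage (measurable_add_const _))
  have hdisj : Pairwise (Function.onFun Disjoint T) := by
    intro k l hkl
    refine Set.disjoint_left.2 fun x hx hy => hkl ?_
    obtain ⟨-, -, z, hz, hxz⟩ := hx
    obtain ⟨-, -, w, hw, hxw⟩ := hy
    have := hinj _ hxz _ hxw (z - w + Pi.single i (k - l)) fun j => by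
      rcases eq_or_ne j i with rfl | hj
      · simp; ring
      · simp [hj]
    simp [hz i hi, hw i hi] at this
    omega
  have hsub : (⋃ k, T k) ⊆ latticeReduction (insert i J) S := by
    refine Set.iUnion_subset fun k x hx => ?_
    obtain ⟨h0, h1, z, hz, hxz⟩ := hx
    refine ⟨fun j hj => ?_, z + Pi.single i k, fun j hj => ?_, ?_⟩
    · rcases Finset.mem_insert.1 hj with rfl | hj'
      · exact h0
      · have hne : j ≠ i := fun h => hi (h ▸ hj')
        simpa [hne] using h1 j hj'
    · rw [Finset.mem_insert, not_or] at hj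
      simp [hj.1, hz j hj.2]
    · convert hxz using 2 with j
      rcases eq_or_ne j i with rfl | hj
      · simp; ring
      · simp [hj]
  set W : ℤ → Set (ι → ℝ) := fun k => {x | x + Pi.single i (-k : ℝ) ∈ T k} with hW
  have hWT : ∀ k, volume (W k) = volume (T k) := fun k =>
    measure_preimage_add_right volume (Pi.single i (-(k : ℝ)) : ι → ℝ) (T k)
  have hcov : U ⊆ ⋃ k, W k := by
    intro x hx
    refine Set.mem_iUnion.2 ⟨⌊x i⌋, ?_⟩
    rw [hW, Set.mem_ofPred_eq, hT, Set.mem_ofPred_eq]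
    constructor
    · rw [Pi.add_apply, Pi.single_eq_same]
      exact ⟨by linarith [Int.floor_le (x i)], by linarith [Int.lt_floor_add_one (x i)]⟩
    · rwa [add_assoc, ← Pi.single_add, neg_add_cancel, Pi.single_zero, add_zero]
  calc volume U ≤ ∑' k, volume (W k) := (measure_mono hcov).trans (measure_iUnion_le _)
    _ = ∑' k, volume (T k) := tsum_congr hWT
    _ = volume (⋃ k, T k) := (measure_iUnion hdisj hTm).symm
    _ ≤ _ := measure_mono hsub

/-- Dilating a convex set does not decrease the volume of its reduction modulo `ℤⁿ`. -/
theorem volume_unitCube_reduction_le_dilate [Fintype ι] {C : Set (ι → ℝ)} (hc : Convex ℝ C)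
    (hC : MeasurableSet C) {t : ℝ} (ht : 1 ≤ t) :
    volume {y : ι → ℝ | (∀ j, y j ∈ Set.Ico (0 : ℝ) 1) ∧
        ∃ z : ι → ℤ, (fun j => y j + z j) ∈ C} ≤
      volume {y : ι → ℝ | (∀ j, y j ∈ Set.Ico (0 : ℝ) 1) ∧
        ∃ z : ι → ℤ, (t⁻¹ • fun j => y j + (z j : ℝ)) ∈ C} := by
  rcases C.eq_empty_or_nonempty with rfl | ⟨c, hcC⟩
  · simp
  have ht0 : 0 < t := one_pos.trans_le ht
  set P : Set (ι → ℝ) := {y | ∃ z : ι → ℤ, (t⁻¹ • fun j => y j + (z j : ℝ)) ∈ C} with hP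
  have hPm : MeasurableSet P := by
    have : P = ⋃ z : ι → ℤ, {y | (t⁻¹ • fun j => y j + (z j : ℝ)) ∈ C} := by
      ext; simp [hP]
    rw [this]
    refine MeasurableSet.iUnion fun z => hC.preimage ?_
    have : Measurable fun (y : ι → ℝ) (j : ι) => y j + (z j : ℝ) :=
      measurable_pi_lambda _ fun j => (measurable_pi_apply j).add_const _
    exact this.const_smul t⁻¹
  set b := Pi.basisFun ℝ ι
  have hfd := ZSpan.isAddFundamentalDomain' b (volume : Measure (ι → ℝ))
  have : Countable (Submodule.span ℤ (Set.range b)).toAddSubgroup :=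
    inferInstanceAs (Countable (Submodule.span ℤ (Set.range b)))
  set w := (t - 1) • c with hw
  have key := hfd.measure_set_eq (hfd.vadd_of_comm w) hPm (by
    intro g
    obtain ⟨m, hm⟩ : ∃ m : ι → ℤ, ∀ j, (g : ι → ℝ) j = m j := by
      have := (b.mem_span_iff_repr_mem ℤ (g : ι → ℝ)).1 g.2
      choose m hm using this
      exact ⟨m, fun j => by simpa [b] using (hm j).symm⟩
    ext y
    constructor
    · rintro ⟨z, hz⟩
      refine ⟨m + z, ?_⟩
      convert hz using 3 with j
      simp [AddSubgroup.vadd_def, hm]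
      ring
    · rintro ⟨z, hz⟩
      refine ⟨z - m, ?_⟩
      convert hz using 3 with j
      simp [AddSubgroup.vadd_def, hm]
      ring)
  rw [ZSpan.fundamentalDomain_pi_basisFun] at key
  calc _ ≤ volume ((fun y => w + y) ⁻¹'
        (P ∩ (w +ᵥ Set.univ.pi fun _ : ι => Set.Ico (0 : ℝ) 1))) := by
        refine measure_mono ?_
        rintro y ⟨hy, z, hz⟩
        refine ⟨⟨z, ?_⟩, Set.vadd_mem_vadd_set (a := w) fun j _ => hy j⟩
        have := hc hz hcC (inv_nonneg.2 ht0.le) (sub_nonneg.2 (inv_le_one_of_one_le₀ ht)) (by ring)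
        convert this using 1
        ext j
        simp [hw]
        field_simp
        ring
    _ = volume (P ∩ Set.univ.pi fun _ : ι => Set.Ico (0 : ℝ) 1) := by
        rw [measure_preimage_add, key]
    _ ≤ _ := measure_mono fun y hy => show _ ∧ _ from ⟨fun j => hy.2 j trivial, hy.1⟩

/-- Dilating by `t ≥ 1` multiplies the volume of the reduction by at least `t ^ (n - |J|)`. -/
theorem pow_mul_volume_latticeReduction_le [Fintype ι] [DecidableEq ι] (J : Finset ι)
    {S : Set (ι → ℝ)} (hc : Convex ℝ S) (hS : MeasurableSet S) {t : ℝ} (ht : 1 ≤ t) :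
    ENNReal.ofReal (t ^ (Fintype.card ι - J.card)) * volume (latticeReduction J S) ≤
      volume (latticeReduction J (t • S)) := by
  have ht0 : 0 < t := one_pos.trans_le ht
  set d : ι → ℝ := fun j => if j ∈ J then 1 else t⁻¹ with hd
  set φ : (ι → ℝ) →ₗ[ℝ] (ι → ℝ) := Matrix.toLin' (Matrix.diagonal d) with hφ
  have hφa : ∀ x j, φ x j = d j * x j := fun x j => by simp [hφ, Matrix.mulVec_diagonal]
  have hdet : LinearMap.det φ = (t ^ (Fintype.card ι - J.card))⁻¹ := by
    rw [hφ, LinearMap.det_toLin', Matrix.det_diagonal, hd, Finset.prod_ite]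
    simp only [Finset.prod_const_one, one_mul, Finset.prod_const, inv_pow]
    congr 2
    rw [← Finset.card_compl]
    congr 1
    ext; simp
  have htp : 0 < t ^ (Fintype.card ι - J.card) := pow_pos ht0 _
  have hvol := Measure.addHaar_preimage_linearMap volume (f := φ) (by rw [hdet]; positivity)
    (latticeReduction J S)
  rw [hdet, inv_inv, abs_of_pos htp] at hvol
  rw [← hvol]
  have hmem : ∀ (T : Set (ι → ℝ)) (x : ι → ℝ), φ x ∈ latticeReduction J T ↔
      x ∈ latticeReduction J (φ ⁻¹' T) := by
    intro T x
    refine and_congr (forall₂_congr fun j hj => by rw [hφa]; simp [hd, hj])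
      (exists_congr fun z => and_congr_right fun hz => ?_)
    rw [Set.mem_preimage]
    have : (fun j => φ x j + (z j : ℝ)) = φ fun j => x j + z j := by
      ext j
      rw [hφa, hφa]
      by_cases hj : j ∈ J <;> simp [hd, hj, hz]
    rw [this]
  have hpre : φ ⁻¹' latticeReduction J S = latticeReduction J (φ ⁻¹' S) := Set.ext (hmem S)
  rw [hpre]
  set S' := φ ⁻¹' S with hS'
  have hφc : Continuous φ := φ.continuous_of_finiteDimensional
  have hS'm : MeasurableSet S' := hS.preimage hφc.measurable
  have hS'c : Convex ℝ S' := hc.linear_preimage φ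
  have htS : MeasurableSet (t • S) := hS.const_smul₀ t
  have hm₁ := measurableSet_latticeReduction J hS'm
  have hm₂ := measurableSet_latticeReduction J htS
  rw [← lintegral_indicator_one hm₁, ← lintegral_indicator_one hm₂]
  change ∫⁻ x, _ ∂(Measure.pi fun _ => volume) ≤ ∫⁻ x, _ ∂(Measure.pi fun _ => volume)
  rw [lintegral_eq_lmarginal_univ 0, lintegral_eq_lmarginal_univ 0, ← J.union_compl,
    lmarginal_union' _ _ (measurable_one.indicator hm₁) disjoint_compl_right,
    lmarginal_union' _ _ (measurable_one.indicator hm₂) disjoint_compl_right]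
  refine lmarginal_mono (fun x => ?_) _
  have hu : ∀ (y : J → ℝ) (T : Set (ι → ℝ)), Function.updateFinset x J y ∈ latticeReduction J T ↔
      (∀ j, y j ∈ Set.Ico (0 : ℝ) 1) ∧ ∃ z : J → ℤ,
        Function.updateFinset x J (fun j => y j + z j) ∈ T := by
    intro y T
    constructor
    · rintro ⟨h1, z, hz, h2⟩
      refine ⟨fun j => by simpa [Function.updateFinset] using h1 j j.2, fun j => z j, ?_⟩
      convert h2 using 1
      ext j
      by_cases hj : j ∈ J <;> simp [Function.updateFinset, hj, hz]
    · rintro ⟨h1, z, h2⟩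
      refine ⟨fun j hj => by simpa [Function.updateFinset, hj] using h1 ⟨j, hj⟩,
        Function.updateFinset 0 J z, fun j hj => by simp [Function.updateFinset, hj], ?_⟩
      convert h2 using 1
      ext j
      by_cases hj : j ∈ J <;> simp [Function.updateFinset, hj]
  have hum : Measurable fun y : J → ℝ => Function.updateFinset x J y := measurable_updateFinset
  set C : Set (J → ℝ) := {y | Function.updateFinset x J y ∈ S'} with hC
  have hCm : MeasurableSet C := hS'm.preimage hum
  have hCc : Convex ℝ C := by
    intro y hy z hz a b ha hb hab
    have := hS'c hy hz ha hb hab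
    rw [hC, Set.mem_ofPred_eq]
    convert this using 1
    ext j
    by_cases hj : j ∈ J
    · simp [Function.updateFinset, hj]
    · simp [Function.updateFinset, hj, ← add_mul, hab]
  have hle := volume_unitCube_reduction_le_dilate hCc hCm ht
  have hind : ∀ T : Set (ι → ℝ), MeasurableSet (latticeReduction J T) →
      (∫⋯∫⁻_J, (latticeReduction J T).indicator 1 ∂fun _ => volume) x =
      volume {y : J → ℝ | Function.updateFinset x J y ∈ latticeReduction J T} := by
    intro T hT
    exact lintegral_indicator_one (hT.preimage hum)
  rw [hind _ hm₁, hind _ hm₂]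
  simp only [hu]
  refine hle.trans (measure_mono ?_)
  rintro y ⟨h1, z, h2⟩
  refine ⟨h1, z, φ (Function.updateFinset x J (t⁻¹ • fun j => y j + (z j : ℝ))), h2, ?_⟩
  ext j
  simp only [Pi.smul_apply, smul_eq_mul, hφa]
  by_cases hj : j ∈ J
  · simp [Function.updateFinset, hj, hd, ht0.ne']
  · simp [Function.updateFinset, hj, hd, ht0.ne']

end LatticeReduction

section MinkowskiSecond

theorem card_filter_val_lt {n i : ℕ} (hi : i ≤ n) :
    (Finset.univ.filter fun j : Fin n => j.val < i).card = i := by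
  rw [Fin.card_filter_val_lt, min_eq_right hi]

theorem filter_val_lt_succ {n i : ℕ} (hi : i < n) :
    (Finset.univ.filter fun j : Fin n => j.val < i + 1) =
      insert ⟨i, hi⟩ (Finset.univ.filter fun j : Fin n => j.val < i) := by
  ext j
  simp only [Finset.mem_filter, Finset.mem_univ, true_and, Finset.mem_insert, Fin.ext_iff]
  omega

theorem volume_latticeReduction_le_succ {n i : ℕ} (hi : i < n) {A : Set (Fin n → ℝ)}
    (hc : Convex ℝ A) (hA : MeasurableSet A) (hs : ∀ x ∈ A, -x ∈ A) {r : ℝ}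
    (h : ∀ z : Fin n → ℤ, (fun j => (z j : ℝ)) ∈ r • A → ∀ j : Fin n, i ≤ j → z j = 0) :
    volume (latticeReduction (Finset.univ.filter fun j : Fin n => j.val < i) ((r / 2) • A)) ≤
      volume (latticeReduction (Finset.univ.filter fun j : Fin n => j.val < i + 1)
        ((r / 2) • A)) := by
  rw [filter_val_lt_succ hi]
  refine volume_latticeReduction_le_insert (by simp) (hA.const_smul₀ _) ?_
  rintro _ ⟨a, ha, rfl⟩ _ ⟨b, hb, rfl⟩ z hz
  refine h z ⟨_, hc ha (hs b hb) (by norm_num : (0 : ℝ) ≤ 2⁻¹) (by norm_num : (0 : ℝ) ≤ 2⁻¹)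
    (by norm_num), ?_⟩ ⟨i, hi⟩ le_rfl
  ext j
  rw [← hz j]
  simp
  ring

theorem volume_mul_prod_le_latticeReduction {n : ℕ} {A : Set (Fin n → ℝ)}
    (hc : Convex ℝ A) (hA : MeasurableSet A) (hs : ∀ x ∈ A, -x ∈ A) {l : ℕ → ℝ}
    (hpos : ∀ i < n, 0 < l i) (hmono : ∀ i, i + 1 < n → l i ≤ l (i + 1))
    (h : ∀ i < n, ∀ z : Fin n → ℤ, (fun j => (z j : ℝ)) ∈ l i • A →
      ∀ j : Fin n, i ≤ j → z j = 0) (i : ℕ) (hi : i < n) :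
    volume A * ENNReal.ofReal ((∏ k ∈ Finset.range i, l k) * l i ^ (n - i)) ≤
      2 ^ n * volume (latticeReduction (Finset.univ.filter fun j : Fin n => j.val < i)
        ((l i / 2) • A)) := by
  induction i with
  | zero =>
    have h0 := (hpos 0 hi).le
    have : (Finset.univ.filter fun j : Fin n => j.val < 0) = ∅ := by simp
    rw [this, latticeReduction_empty, Measure.addHaar_smul, Module.finrank_fin_fun,
      abs_of_nonneg (by positivity), ← mul_assoc, mul_comm, div_pow,
      ← ENNReal.ofReal_ofNat, ← ENNReal.ofReal_pow (by norm_num),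
      ← ENNReal.ofReal_mul (by norm_num)]
    refine le_of_eq ?_
    congr 2
    simp
    field_simp
  | succ i ih =>
    have hi' : i < n := by omega
    have p0 := hpos i hi'
    have p1 := hpos (i + 1) hi
    have ht : 1 ≤ l (i + 1) / l i := (one_le_div p0).2 (hmono i hi)
    have hP : 0 ≤ ∏ k ∈ Finset.range i, l k :=
      Finset.prod_nonneg fun k hk => (hpos k (by have := Finset.mem_range.1 hk; omega)).le
    have step := pow_mul_volume_latticeReduction_le
      (Finset.univ.filter fun j : Fin n => j.val < i + 1) (hc.smul (l i / 2))
      (hA.const_smul₀ (l i / 2)) ht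
    rw [card_filter_val_lt hi.le, Fintype.card_fin, smul_smul,
      show l (i + 1) / l i * (l i / 2) = l (i + 1) / 2 by field_simp] at step
    have hsucc := volume_latticeReduction_le_succ hi' hc hA hs (h i hi')
    have e : (∏ k ∈ Finset.range (i + 1), l k) * l (i + 1) ^ (n - (i + 1)) =
        (∏ k ∈ Finset.range i, l k) * l i ^ (n - i) * (l (i + 1) / l i) ^ (n - (i + 1)) := by
      rw [Finset.prod_range_succ, show n - i = (n - (i + 1)) + 1 by omega, div_pow, pow_succ]
      field_simp
    rw [e, ENNReal.ofReal_mul (by positivity), ← mul_assoc]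
    calc _ ≤ 2 ^ n * volume (latticeReduction (Finset.univ.filter fun j : Fin n => j.val < i + 1)
          ((l i / 2) • A)) * ENNReal.ofReal ((l (i + 1) / l i) ^ (n - (i + 1))) := by
          refine mul_le_mul_left ((ih hi').trans ?_) _
          gcongr
      _ ≤ _ := by
          rw [mul_assoc, mul_comm (volume _)]
          gcongr

theorem volume_mul_prod_le_two_pow {n : ℕ} {A : Set (Fin n → ℝ)}
    (hc : Convex ℝ A) (hA : MeasurableSet A) (hs : ∀ x ∈ A, -x ∈ A) {l : ℕ → ℝ}
    (hpos : ∀ i < n, 0 < l i) (hmono : ∀ i, i + 1 < n → l i ≤ l (i + 1))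
    (h : ∀ i < n, ∀ z : Fin n → ℤ, (fun j => (z j : ℝ)) ∈ l i • A →
      ∀ j : Fin n, i ≤ j → z j = 0) :
    volume A * ENNReal.ofReal (∏ k ∈ Finset.range n, l k) ≤ 2 ^ n := by
  rcases n with _ | n
  · have := volume_latticeReduction_univ_le_one A
    rw [Finset.univ_eq_empty, latticeReduction_empty] at this
    simpa using this
  have hn := Nat.lt_succ_self n
  have := volume_mul_prod_le_latticeReduction hc hA hs hpos hmono h n hn
  rw [Finset.prod_range_succ]
  rw [Nat.add_sub_cancel_left, pow_one] at this
  refine this.trans (mul_le_of_le_one_right zero_le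
    ((volume_latticeReduction_le_succ hn hc hA hs (h n hn)).trans ?_))
  have e : (Finset.univ.filter fun j : Fin (n + 1) => j.val < n + 1) = Finset.univ := by
    ext j; simp [j.is_le]
  rw [e]
  exact volume_latticeReduction_univ_le_one _

/-- A set containing no `m + 1` linearly independent vectors of a free abelian group of rank
`m + 1` is annihilated by a surjective functional. -/
theorem exists_functional_surjective_of_not_linearIndependent {M : Type*} [AddCommGroup M] {m : ℕ}
    (e : Module.Basis (Fin (m + 1)) ℤ M) {Z : Set M}
    (hZ : ∀ v : Fin (m + 1) → M, (∀ k, v k ∈ Z) → ¬ LinearIndependent ℤ v) :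
    ∃ (φ : M →ₗ[ℤ] ℤ) (y : M), φ y = 1 ∧ ∀ z ∈ Z, φ z = 0 := by
  obtain ⟨s, hs, hmax⟩ := exists_maximal_linearIndepOn ℤ (Subtype.val : Z → M)
  set N := Submodule.span ℤ (Subtype.val '' s) with hN
  obtain ⟨k, snf⟩ := Submodule.smithNormalForm e N
  have hs' : LinearIndependent ℤ fun i : s => (i : Z).val := hs
  have : Module.Finite ℤ M := Module.Finite.of_basis e
  have hfin : Finite s := hs'.finite
  have := Fintype.ofFinite s
  have hcard : Fintype.card s < m + 1 := by
    by_contra! hle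
    obtain ⟨f⟩ : Nonempty (Fin (m + 1) ↪ s) :=
      Function.Embedding.nonempty_of_card_le (by simpa using hle)
    exact hZ (fun i => (f i : Z).val) (fun i => (f i : Z).2) (hs'.comp f f.injective)
  have hk : k ≤ Fintype.card s := by
    have h1 : Module.finrank ℤ N = k := by
      rw [Module.finrank_eq_card_basis snf.bN, Fintype.card_fin]
    have h2 : N = Submodule.span ℤ (Set.range fun i : s => (i : Z).val) := by
      rw [hN, Set.image_eq_range]
    rw [← h1, h2, finrank_span_eq_card hs']
  obtain ⟨j, hj⟩ : ∃ j, j ∉ Set.range snf.f := by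
    by_contra! hsurj
    have := Fintype.card_le_of_surjective snf.f hsurj
    simp at this
    omega
  refine ⟨snf.bM.coord j, snf.bM j, by simp, fun z hz => ?_⟩
  have hker : N ≤ LinearMap.ker (snf.bM.coord j) := by
    intro x hx
    have : (⟨x, hx⟩ : N) ∈ Submodule.span ℤ (Set.range snf.bN) := by simp
    have h2 : Submodule.span ℤ (Set.range snf.bN) ≤
        (LinearMap.ker (snf.bM.coord j)).comap N.subtype := by
      rw [Submodule.span_le]
      rintro _ ⟨i, rfl⟩
      have hne : snf.f i ≠ j := fun h => hj ⟨i, h⟩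
      simp [snf.snf, hne]
    exact h2 this
  by_cases h : (⟨z, hz⟩ : Z) ∈ s
  · exact hker (Submodule.subset_span ⟨_, h, rfl⟩)
  · obtain ⟨a, ha, hmem⟩ := hmax _ h
    have := hker hmem
    rw [LinearMap.mem_ker, map_smul, smul_eq_mul] at this
    exact (mul_eq_zero.1 this).resolve_left ha

theorem exists_basis_adapted (m : ℕ) : ∀ {M : Type*} [AddCommGroup M]
    (_ : Module.Basis (Fin m) ℤ M) (Z : ℕ → Set M)
    (_ : ∀ i j, i ≤ j → j < m → Z i ⊆ Z j)
    (_ : ∀ i < m, ∀ v : Fin (i + 1) → M, (∀ k, v k ∈ Z i) → ¬ LinearIndependent ℤ v),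
    ∃ b : Module.Basis (Fin m) ℤ M, ∀ i < m, ∀ z ∈ Z i, ∀ j : Fin m, i ≤ j → b.repr z j = 0 := by
  induction m with
  | zero => exact fun e _ _ _ => ⟨e, fun i hi => absurd hi (Nat.not_lt_zero i)⟩
  | succ m ih =>
    intro M _ e Z hZ h
    obtain ⟨φ, y, hy, hφ⟩ := exists_functional_surjective_of_not_linearIndependent e
      (h m (Nat.lt_succ_self m))
    set N := LinearMap.ker φ with hN
    have hli : ∀ c : ℤ, ∀ x ∈ N, c • y + x = 0 → c = 0 := by
      intro c x hx hcx
      have := congrArg φ hcx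
      simpa [hy, LinearMap.mem_ker.1 hx] using this
    have hsp : ∀ z : M, ∃ c : ℤ, z + c • y ∈ N := fun z => ⟨-φ z, by simp [hN, hy]⟩
    obtain ⟨k, bN⟩ := Submodule.basisOfPid e N
    have hk : k = m := by
      have e2 := Module.Basis.mkFinSnoc bN y hli hsp
      have := e2.indexEquiv e
      have := Fintype.card_congr this
      simpa using this
    subst hk
    obtain ⟨b, hb⟩ := ih bN (fun i => N.subtype ⁻¹' Z i)
      (fun i j hij hj => Set.preimage_mono (hZ i j hij (by omega))) (by
        intro i hi v hv hlin
        exact h i (by omega) (fun k => v k) hv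
          (hlin.map' N.subtype (Submodule.ker_subtype N)))
    refine ⟨Module.Basis.mkFinSnoc b y hli hsp, fun i hi z hz j hij => ?_⟩
    have hzN : z ∈ N := hφ z (hZ i k (Nat.lt_succ_iff.1 hi) (Nat.lt_succ_self k) hz)
    have hz' : z = ∑ j : Fin k, b.repr ⟨z, hzN⟩ j • (b j : M) := by
      have := congrArg N.subtype (b.sum_repr ⟨z, hzN⟩)
      rw [map_sum] at this
      exact this.symm
    set B := Module.Basis.mkFinSnoc b y hli hsp with hB
    have hBj : ∀ j : Fin k, B j.castSucc = b j := fun j => by simp [hB, Module.Basis.coe_mkFinSnoc]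
    have hrepr : B.repr z = ∑ j : Fin k, Finsupp.single j.castSucc (b.repr ⟨z, hzN⟩ j) := by
      conv_lhs => rw [hz']
      rw [map_sum]
      refine Finset.sum_congr rfl fun j _ => ?_
      rw [map_smul, ← hBj, B.repr_self, Finsupp.smul_single, smul_eq_mul, mul_one]
    rw [hrepr, Finsupp.finsetSum_apply]
    refine Finset.sum_eq_zero fun l _ => ?_
    rw [Finsupp.single_apply]
    split_ifs with hl
    · subst hl
      have hij' : i ≤ (l : ℕ) := hij
      exact hb i (hij'.trans_lt l.2) _ hz l hij'
    · rfl

end MinkowskiSecond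

section SuccessiveMinima

theorem LinearIndependent.intCast_pi {ι κ : Type*} [Fintype ι] {v : κ → ι → ℤ}
    (hv : LinearIndependent ℤ v) : LinearIndependent ℝ fun k j => (v k j : ℝ) := by
  classical
  have h := Module.Flat.linearIndependent_one_tmul (S := ℝ) hv
  have := h.map' (TensorProduct.piScalarRight ℤ ℝ ℝ ι).toLinearMap (LinearEquiv.ker _)
  have e : (fun k j => (v k j : ℝ)) =
      (TensorProduct.piScalarRight ℤ ℝ ℝ ι).toLinearMap ∘
        fun k => TensorProduct.tmul ℤ 1 (v k) := by
    ext k j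
    simp [TensorProduct.piScalarRight]
  rw [e]
  exact this

/-- The volume bound of Minkowski's second theorem, with the successive minima given through the
gauge of the body. -/
theorem volume_mul_prod_le_two_pow_of_gauge {n : ℕ} {P : Set (Fin n → ℝ)} (hc : Convex ℝ P)
    (h0 : P ∈ nhds 0) (hs : ∀ x ∈ P, -x ∈ P) {l : ℕ → ℝ} (hpos : ∀ i < n, 0 < l i)
    (hmono : ∀ i j, i ≤ j → j < n → l i ≤ l j)
    (h : ∀ i < n, ∀ v : Fin (i + 1) → Fin n → ℤ, LinearIndependent ℤ v →
      ∃ k, l i ≤ gauge P fun j => (v k j : ℝ)) :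
    volume P * ENNReal.ofReal (∏ k ∈ Finset.range n, l k) ≤ 2 ^ n := by
  obtain ⟨b, hb⟩ := exists_basis_adapted n (Pi.basisFun ℤ (Fin n))
    (fun i => {z : Fin n → ℤ | gauge P (fun j => (z j : ℝ)) < l i})
    (fun i j hij hj z hz => lt_of_lt_of_le hz (hmono i j hij hj))
    (fun i hi v hv hlin => by
      obtain ⟨k, hk⟩ := h i hi v hlin
      exact absurd (hv k) (not_lt.2 hk))
  set B : Matrix (Fin n) (Fin n) ℤ := (Pi.basisFun ℤ (Fin n)).toMatrix b with hB
  have hBdet : |(B.det : ℝ)| = 1 := by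
    have : IsUnit B.det := (Pi.basisFun ℤ (Fin n)).isUnit_det b
    rcases Int.isUnit_iff.1 this with h | h <;> simp [h]
  set T : (Fin n → ℝ) →ₗ[ℝ] (Fin n → ℝ) := Matrix.toLin' (B.map (Int.castRingHom ℝ)) with hT
  have hTdet : LinearMap.det T = B.det := by
    rw [hT, LinearMap.det_toLin', ← RingHom.mapMatrix_apply, ← RingHom.map_det]
    rfl
  have hTz : ∀ z : Fin n → ℤ, T (fun j => (z j : ℝ)) = fun j => ((∑ k, z k • b k) j : ℝ) := by
    intro z
    ext j
    simp [hT, hB, Matrix.mulVec, dotProduct, Module.Basis.toMatrix_apply, mul_comm]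
  have hvol : volume (T ⁻¹' interior P) = volume P := by
    rw [Measure.addHaar_preimage_linearMap volume
      (by rw [hTdet]; exact fun h => by simp [h] at hBdet), hTdet, abs_inv, hBdet]
    simp only [inv_one, ENNReal.ofReal_one, one_mul]
    refine le_antisymm (measure_mono interior_subset) ?_
    calc volume P ≤ volume (interior P ∪ frontier P) :=
          measure_mono (subset_closure.trans (closure_eq_interior_union_frontier P).subset)
      _ ≤ volume (interior P) + volume (frontier P) := measure_union_le _ _
      _ = volume (interior P) := by rw [hc.addHaar_frontier volume, add_zero]
  rw [← hvol]
  have hTc : Continuous T := T.continuous_of_finiteDimensional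
  refine volume_mul_prod_le_two_pow (hc.interior.linear_preimage T)
    (isOpen_interior.measurableSet.preimage hTc.measurable) ?_ hpos
    (fun i hi => hmono i (i + 1) (Nat.le_succ i) hi) ?_
  · intro x hx
    rw [Set.mem_preimage, ← setOfPred_gauge_lt_one_eq_interior hc h0] at hx ⊢
    rwa [map_neg, Set.mem_ofPred_eq, gauge_neg hs]
  · rintro i hi z ⟨a, ha, haz⟩ j hij
    have hga : gauge P (T a) < 1 := by
      rwa [Set.mem_preimage, ← setOfPred_gauge_lt_one_eq_interior hc h0] at ha
    have hz : gauge P (T fun j => (z j : ℝ)) < l i := by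
      rw [← haz]
      change gauge P (T (l i • a)) < l i
      rw [map_smul, gauge_smul_of_nonneg (hpos i hi).le, smul_eq_mul]
      nlinarith [hpos i hi]
    rw [hTz] at hz
    have := hb i hi _ hz j hij
    rwa [Module.Basis.repr_sum_self] at this

end SuccessiveMinima

section Transfer

theorem mem_smul_iff_gauge_le {V : Type*} [NormedAddCommGroup V] [NormedSpace ℝ V] {P : Set V}
    (hc : Convex ℝ P) (hP : IsClosed P) (h0 : P ∈ nhds 0) {r : ℝ} (hr : 0 < r) {x : V} :
    x ∈ r • P ↔ gauge P x ≤ r := by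
  have h := gauge_le_one_iff_mem_closure hc h0 (x := r⁻¹ • x)
  rw [hP.closure_eq, gauge_smul_of_nonneg (inv_nonneg.2 hr.le), smul_eq_mul,
    inv_mul_le_one₀ hr] at h
  rw [Set.mem_smul_set_iff_inv_smul_mem₀ hr.ne', h]

theorem polarBody_eq_preimage {n : ℕ} (L : Set (E n)) :
    polarBody L = WithLp.ofLp ⁻¹' dotPolar (WithLp.ofLp '' L) := by
  ext y
  simp [polarBody, dotPolar, PiLp.inner_apply, dotProduct, mul_comm]

variable {n : ℕ} {P : Set (Fin n → ℝ)}

/-- The scaling factors whose infimum is the `i`-th successive minimum. -/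
theorem succMin_preimage (hc : Convex ℝ P) (hP : IsClosed P) (h0 : P ∈ nhds 0) (i : ℕ) :
    succMin (WithLp.ofLp ⁻¹' P : Set (E n)) i =
      sInf {r : ℝ | 0 < r ∧ ∃ v : Fin i → Fin n → ℤ,
        LinearIndependent ℤ v ∧ ∀ k, gauge P (fun j => (v k j : ℝ)) ≤ r} := by
  have hmem : ∀ {r : ℝ}, 0 < r → ∀ x : E n,
      x ∈ r • (WithLp.ofLp ⁻¹' P : Set (E n)) ↔ gauge P x.ofLp ≤ r := by
    intro r hr x
    rw [← mem_smul_iff_gauge_le hc hP h0 hr, Set.mem_smul_set_iff_inv_smul_mem₀ hr.ne',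
      Set.mem_smul_set_iff_inv_smul_mem₀ hr.ne']
    rfl
  have hli : ∀ v : Fin i → Fin n → ℤ, LinearIndependent ℤ v ↔
      LinearIndependent ℝ fun k => (WithLp.toLp 2 fun j => (v k j : ℝ) : E n) := by
    intro v
    have h2 : LinearIndependent ℝ (fun k => (WithLp.toLp 2 fun j => (v k j : ℝ) : E n)) ↔
        LinearIndependent ℝ fun k j => (v k j : ℝ) :=
      (LinearMap.linearIndependent_iff_of_injOn
        (WithLp.linearEquiv 2 ℝ (Fin n → ℝ)).symm.toLinearMap
        (v := fun k j => (v k j : ℝ)) ((LinearEquiv.injective _).injOn))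
    rw [h2]
    refine ⟨LinearIndependent.intCast_pi, fun h => ?_⟩
    have h3 : LinearIndependent ℤ fun k j => (v k j : ℝ) :=
      h.restrict_scalars fun a b hab => by simpa using hab
    exact LinearIndependent.of_comp ((Int.castAddHom ℝ).toIntLinearMap.compLeft (Fin n)) h3
  rw [succMin]
  congr 1
  ext r
  refine and_congr_right fun hr => ⟨?_, ?_⟩
  · rintro ⟨v, hv, h⟩
    choose w hw using fun k => (h k).1
    have e : v = fun k => (WithLp.toLp 2 fun j => (w k j : ℝ) : E n) := by
      ext k j
      exact hw k j
    rw [e] at hv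
    refine ⟨w, (hli w).2 hv, fun k => ?_⟩
    have := (hmem hr _).1 (h k).2
    rwa [e] at this
  · rintro ⟨v, hv, h⟩
    exact ⟨_, (hli v).1 hv, fun k => ⟨fun j => ⟨v k j, rfl⟩, (hmem hr _).2 (h k)⟩⟩

theorem succMin_le_of_linearIndependent (hc : Convex ℝ P) (hP : IsClosed P) (h0 : P ∈ nhds 0)
    (hb : Bornology.IsBounded P) {i : ℕ} {v : Fin (i + 1) → Fin n → ℤ}
    (hv : LinearIndependent ℤ v) :
    ∃ k, succMin (WithLp.ofLp ⁻¹' P : Set (E n)) (i + 1) ≤ gauge P fun j => (v k j : ℝ) := by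
  obtain ⟨k, -, hk⟩ := Finset.exists_max_image Finset.univ
    (fun k => gauge P fun j => (v k j : ℝ)) Finset.univ_nonempty
  refine ⟨k, ?_⟩
  rw [succMin_preimage hc hP h0]
  refine csInf_le ⟨0, fun r hr => hr.1.le⟩ ⟨?_, v, hv, fun l => hk l (Finset.mem_univ l)⟩
  rw [gauge_pos (absorbent_nhds_zero h0) (NormedSpace.isVonNBounded_of_isBounded ℝ hb)]
  intro h
  refine hv.ne_zero k (funext fun j => ?_)
  simpa using congrFun h j

theorem exists_linearIndependent_gauge_le {i : ℕ} (hi : i ≤ n) :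
    ∃ r : ℝ, 0 < r ∧ ∃ v : Fin i → Fin n → ℤ,
        LinearIndependent ℤ v ∧ ∀ k, gauge P (fun j => (v k j : ℝ)) ≤ r := by
  set v : Fin i → Fin n → ℤ := fun k => Pi.basisFun ℤ (Fin n) (Fin.castLE hi k) with hv
  have hnn : ∀ k, 0 ≤ gauge P fun j => (v k j : ℝ) := fun k => gauge_nonneg _
  refine ⟨1 + ∑ k, gauge P (fun j => (v k j : ℝ)),
    add_pos_of_pos_of_nonneg one_pos (Finset.sum_nonneg fun k _ => hnn k), v,
    (Pi.basisFun ℤ (Fin n)).linearIndependent.comp _ (Fin.castLE_injective hi), fun k => ?_⟩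
  have := Finset.single_le_sum (fun k _ => hnn k) (Finset.mem_univ k)
  linarith

theorem succMin_pos (hc : Convex ℝ P) (hP : IsClosed P) (h0 : P ∈ nhds 0)
    (hb : Bornology.IsBounded P) {i : ℕ} (hi : i + 1 ≤ n) :
    0 < succMin (WithLp.ofLp ⁻¹' P : Set (E n)) (i + 1) := by
  obtain ⟨R, hR, hPR⟩ := hb.subset_closedBall_lt 0 0
  rw [succMin_preimage hc hP h0]
  refine (one_div_pos.2 hR).trans_le (le_csInf (exists_linearIndependent_gauge_le hi) ?_)
  rintro r ⟨-, v, hv, h⟩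
  refine le_trans ?_ (h 0)
  refine le_trans ?_ (le_gauge_of_subset_closedBall (absorbent_nhds_zero h0) hR.le hPR)
  gcongr
  obtain ⟨j, hj⟩ := Function.ne_iff.1 (hv.ne_zero 0)
  calc (1 : ℝ) ≤ |(v 0 j : ℝ)| := by exact_mod_cast Int.one_le_abs hj
    _ ≤ _ := norm_le_pi_norm (fun j => (v 0 j : ℝ)) j

theorem succMin_mono (hc : Convex ℝ P) (hP : IsClosed P) (h0 : P ∈ nhds 0) {i j : ℕ}
    (hij : i ≤ j) (hj : j ≤ n) :
    succMin (WithLp.ofLp ⁻¹' P : Set (E n)) i ≤ succMin (WithLp.ofLp ⁻¹' P : Set (E n)) j := by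
  rw [succMin_preimage hc hP h0, succMin_preimage hc hP h0]
  refine csInf_le_csInf ⟨0, fun r hr => hr.1.le⟩ (exists_linearIndependent_gauge_le hj) ?_
  rintro r ⟨hr, v, hv, h⟩
  exact ⟨hr, fun k => v (Fin.castLE hij k), hv.comp _ (Fin.castLE_injective hij),
    fun k => h _⟩

/-- The upper bound of Minkowski's second theorem. -/
theorem volume_mul_prod_succMin_le (hc : Convex ℝ P) (hP : IsCompact P) (h0 : P ∈ nhds 0)
    (hs : ∀ x ∈ P, -x ∈ P) :
    (volume P).toReal * ∏ i ∈ Finset.Icc 1 n, succMin (WithLp.ofLp ⁻¹' P : Set (E n)) i ≤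
      2 ^ n := by
  have hl := fun i hi => succMin_pos hc hP.isClosed h0 hP.isBounded (i := i) hi
  have key := volume_mul_prod_le_two_pow_of_gauge hc h0 hs
    (l := fun i => succMin (WithLp.ofLp ⁻¹' P : Set (E n)) (i + 1)) hl
    (fun i j hij hj => succMin_mono hc hP.isClosed h0 (Nat.succ_le_succ hij) hj)
    (fun i _ v hv => succMin_le_of_linearIndependent hc hP.isClosed h0 hP.isBounded hv)
  have hprod : ∏ i ∈ Finset.Icc 1 n, succMin (WithLp.ofLp ⁻¹' P : Set (E n)) i =
      ∏ k ∈ Finset.range n, succMin (WithLp.ofLp ⁻¹' P : Set (E n)) (k + 1) := by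
    rw [Finset.range_eq_Ico, Finset.prod_Ico_add' (fun i => succMin _ i) 0 n 1]
    rfl
  rw [hprod]
  have hnn : 0 ≤ ∏ k ∈ Finset.range n, succMin (WithLp.ofLp ⁻¹' P : Set (E n)) (k + 1) :=
    Finset.prod_nonneg fun k hk => (hl k (Finset.mem_range.1 hk)).le
  have := ENNReal.toReal_mono (by finiteness) key
  rwa [ENNReal.toReal_mul, ENNReal.toReal_ofReal hnn, ENNReal.toReal_pow,
    ENNReal.toReal_ofNat] at this

end Transfer

theorem volume_product_lower_bound (n : ℕ) (K : Set (E n)) (hK : IsConvexBody K) :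
    (2 ^ n / (Nat.choose (2 * n) n : ℝ)) * (Real.pi ^ n / (Nat.factorial n : ℝ))
        ≤ (volume K).toReal * (volume (polarBody (csBody K))).toReal ∧
    (Real.pi / 2) ^ n / (Nat.factorial n : ℝ)
        ≤ (volume K).toReal * (volume (polarBody (csBody K))).toReal ∧
    ((Real.pi / 4) ^ n / (Nat.factorial n : ℝ)) *
        ∏ i ∈ Finset.Icc 1 n, succMin (polarBody (csBody K)) i
      ≤ (volume K).toReal := by
  obtain ⟨hc, hcomp, hi⟩ := hK
  have hsub : IsCompact (K - K) := by
    rw [sub_eq_add_neg]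
    exact hcomp.add hcomp.neg
  have hLc : Convex ℝ (csBody K) := (hc.sub hc).smul _
  have hLk : IsCompact (csBody K) := hsub.smul _
  have hL0 : csBody K ∈ nhds 0 := by
    have := (set_smul_mem_nhds_zero_iff (by norm_num : (2⁻¹ : ℝ) ≠ 0)).2
      (sub_self_mem_nhds_zero hi)
    exact this
  have hLs : ∀ x ∈ csBody K, -x ∈ csBody K := by
    rintro _ ⟨_, ⟨a, ha, b, hb, rfl⟩, rfl⟩
    exact ⟨b - a, ⟨b, hb, a, ha, rfl⟩, by simp [← smul_neg]⟩
  set e := PiLp.continuousLinearEquiv 2 ℝ (fun _ : Fin n => ℝ) with he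
  set L : Set (Fin n → ℝ) := WithLp.ofLp '' csBody K with hL
  have hLe : L = e '' csBody K := rfl
  have hL'c : Convex ℝ L := hLe ▸ hLc.linear_image e.toLinearMap
  have hL'k : IsCompact L := hLe ▸ hLk.image e.continuous
  have hL'0 : L ∈ nhds 0 := by
    have := e.toHomeomorph.isOpenMap.image_mem_nhds hL0
    rw [hLe]
    simpa using this
  have hL's : ∀ x ∈ L, -x ∈ L := by
    rintro _ ⟨x, hx, rfl⟩
    exact ⟨-x, hLs x hx, rfl⟩
  have hvolP : volume (polarBody (csBody K)) = volume (dotPolar L) := by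
    rw [polarBody_eq_preimage]
    exact (PiLp.volume_preserving_ofLp (Fin n)).measure_preimage
      (isClosed_dotPolar L).measurableSet.nullMeasurableSet
  have hvolL : volume (csBody K) = volume L := by
    rw [← (PiLp.volume_preserving_ofLp (Fin n)).measure_preimage
      hL'k.isClosed.measurableSet.nullMeasurableSet, hL,
      Set.preimage_image_eq _ (WithLp.ofLp_injective 2)]
  have hPk : IsCompact (dotPolar L) := isCompact_dotPolar hL'0 hL's
  have kup := ENNReal.toReal_mono (ENNReal.mul_ne_top hL'k.measure_lt_top.ne
    (ENNReal.mul_ne_top (ENNReal.natCast_ne_top _) hPk.measure_lt_top.ne))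
    (pi_pow_le_volume_mul_volume_dotPolar hL'c hL'k hL'0 hL's)
  rw [ENNReal.toReal_ofReal (by positivity), Fintype.card_fin, ENNReal.toReal_mul,
    ENNReal.toReal_mul, ENNReal.toReal_natCast, ← hvolP, ← hvolL] at kup
  have rs := ENNReal.toReal_mono
    (ENNReal.mul_ne_top (ENNReal.natCast_ne_top _) hcomp.measure_lt_top.ne)
    (measure_sub_self_le_choose_mul volume hc hcomp hi)
  have hcs : (volume (csBody K)).toReal = (2 ^ n)⁻¹ * (volume (K - K)).toReal := by
    rw [csBody, Measure.addHaar_smul, finrank_euclideanSpace_fin, ENNReal.toReal_mul,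
      abs_of_pos (by positivity), ENNReal.toReal_ofReal (by positivity), inv_pow]
  rw [ENNReal.toReal_mul, ENNReal.toReal_natCast, finrank_euclideanSpace_fin] at rs
  have hmin := volume_mul_prod_succMin_le (convex_dotPolar L) hPk (dotPolar_mem_nhds hL'k)
    (neg_mem_dotPolar hL's)
  rw [← polarBody_eq_preimage, ← hvolP] at hmin
  set k := (volume K).toReal
  set p := (volume (polarBody (csBody K))).toReal
  set c := (volume (csBody K)).toReal
  set s := ∏ i ∈ Finset.Icc 1 n, succMin (polarBody (csBody K)) i
  have hp : 0 ≤ p := ENNReal.toReal_nonneg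
  have hk : 0 ≤ k := ENNReal.toReal_nonneg
  have hf : (0 : ℝ) < n.factorial := by positivity
  have hC : (0 : ℝ) < Nat.choose (2 * n) n := by
    exact_mod_cast Nat.choose_pos (by omega)
  have h1 : (2 ^ n / (Nat.choose (2 * n) n : ℝ)) * (Real.pi ^ n / (Nat.factorial n : ℝ))
      ≤ k * p := by
    rw [div_mul_div_comm, div_le_iff₀ (by positivity)]
    have hck : 2 ^ n * c ≤ Nat.choose (2 * n) n * k := by
      rwa [hcs, mul_inv_cancel_left₀ (by positivity)]
    calc 2 ^ n * Real.pi ^ n ≤ 2 ^ n * (c * (n.factorial * p)) := by gcongr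
      _ = 2 ^ n * c * (n.factorial * p) := by ring
      _ ≤ Nat.choose (2 * n) n * k * (n.factorial * p) := by gcongr
      _ = _ := by ring
  have h2 : (Real.pi / 2) ^ n / (Nat.factorial n : ℝ) ≤ k * p := by
    refine le_trans ?_ h1
    have h4 : (Nat.choose (2 * n) n : ℝ) ≤ 2 ^ n * 2 ^ n := by
      rw [← pow_add, ← two_mul]
      exact_mod_cast Nat.choose_le_two_pow (2 * n) n
    rw [div_pow, div_eq_inv_mul (Real.pi ^ n), mul_div_assoc]
    gcongr
    rw [inv_le_iff_one_le_mul₀ (by positivity), div_mul_eq_mul_div, one_le_div hC]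
    exact h4
  refine ⟨h1, h2, ?_⟩
  have hs : 0 ≤ s := Finset.prod_nonneg fun i _ => Real.sInf_nonneg fun r hr => hr.1.le
  have h4 : (Real.pi / 4) ^ n = (Real.pi / 2) ^ n / 2 ^ n := by
    rw [← div_pow, div_div]
    norm_num
  rw [h4, div_right_comm, div_mul_eq_mul_div, div_le_iff₀ (by positivity)]
  calc (Real.pi / 2) ^ n / n.factorial * s ≤ k * p * s := by gcongr
    _ = k * (p * s) := mul_assoc _ _ _
    _ ≤ k * 2 ^ n := by gcongr
end
end

section
/- Let K be a convex body in ℝ² with the origin in its interior, let u ∈ ℝ² be such that −u is an interior point of K, and let v ∈ ℝ² be such that v/‖v‖_{K*} lies in the relative interior of the edge E = {x ∈ K* : ⟨x, f⟩ = 1} of the polar body K*, where f is a vertex of K. Then v/‖v‖_{(K+u)*} lies in the relative interior of the edge E' = {x ∈ (K+u)* : ⟨x, f+u⟩ = 1} of (K+u)*. -/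
open MeasureTheory
open scoped RealInnerProductSpace Pointwise

noncomputable section

/-- `F` is an edge (one-dimensional face) of the convex set `C`. -/
def IsEdge {n : ℕ} (C F : Set (E n)) : Prop :=
  IsExtreme ℝ C F ∧ Module.finrank ℝ (vectorSpan ℝ F) = 1

/-- The face of the polar body of `K` on the hyperplane dual to `f`. -/
abbrev polarFace {n : ℕ} (K : Set (E n)) (f : E n) : Set (E n) :=
  {x ∈ polarBody K | ⟪x, f⟫ = 1}

/-- The projective map carrying the polar body of `K + u` onto the polar body of `K`. -/
def polarShift {n : ℕ} (u y : E n) : E n := (1 - ⟪u, y⟫)⁻¹ • y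

lemma inner_lt_one_of_mem_interior {n : ℕ} {K : Set (E n)} {z x : E n}
    (hz : z ∈ interior K) (hx : x ∈ polarBody K) : ⟪z, x⟫ < 1 := by
  rcases eq_or_ne x 0 with rfl | hx0
  · simp
  have hcont : Filter.Tendsto (fun t : ℝ => z + t • x) (nhdsWithin 0 (Set.Ioi 0)) (nhds z) := by
    have : Continuous fun t : ℝ => z + t • x := by fun_prop
    simpa using (this.tendsto 0).mono_left nhdsWithin_le_nhds
  obtain ⟨t, htK, ht⟩ :=
    ((hcont.eventually (mem_interior_iff_mem_nhds.1 hz)).and self_mem_nhdsWithin).exists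
  have h := hx _ htK
  rw [inner_add_left, real_inner_smul_left] at h
  have : 0 < t * ⟪x, x⟫ := mul_pos ht (real_inner_self_pos.2 hx0)
  linarith

lemma polarShift_mem_polarBody_iff {n : ℕ} {K : Set (E n)} {u y : E n}
    (hy : 0 < 1 - ⟪u, y⟫) :
    polarShift u y ∈ polarBody K ↔ y ∈ polarBody ((fun x => x + u) '' K) := by
  simp only [polarBody, polarShift, Set.mem_ofPred_eq, Set.forall_mem_image, inner_add_left,
    real_inner_smul_right]
  refine forall₂_congr fun k _ => ?_
  rw [inv_mul_le_iff₀ hy, mul_one, le_sub_iff_add_le]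

lemma inner_polarShift_eq_one_iff {n : ℕ} {u y f : E n} (hy : 0 < 1 - ⟪u, y⟫) :
    ⟪polarShift u y, f⟫ = 1 ↔ ⟪y, f + u⟫ = 1 := by
  rw [polarShift, real_inner_smul_left, inv_mul_eq_one₀ hy.ne', inner_add_right,
    real_inner_comm u y]
  constructor <;> intro h <;> linarith

lemma polarShift_mem_polarFace_iff {n : ℕ} {K : Set (E n)} {u y f : E n}
    (hy : 0 < 1 - ⟪u, y⟫) :
    polarShift u y ∈ polarFace K f ↔ y ∈ polarFace ((fun x => x + u) '' K) (f + u) :=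
  and_congr (polarShift_mem_polarBody_iff hy) (inner_polarShift_eq_one_iff hy)

lemma one_sub_inner_polarShift_neg {n : ℕ} {u x : E n} (hx : 0 < 1 + ⟪u, x⟫) :
    1 - ⟪u, polarShift (-u) x⟫ = (1 + ⟪u, x⟫)⁻¹ := by
  rw [polarShift, inner_neg_left, sub_neg_eq_add, real_inner_smul_right]
  field_simp
  ring

lemma polarShift_polarShift_neg {n : ℕ} {u x : E n} (hx : 0 < 1 + ⟪u, x⟫) :
    polarShift u (polarShift (-u) x) = x := by
  rw [polarShift, one_sub_inner_polarShift_neg hx, inv_inv, polarShift, inner_neg_left,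
    sub_neg_eq_add, smul_inv_smul₀ hx.ne']

lemma polarShift_neg_mem_polarFace {n : ℕ} {K : Set (E n)} {u x f : E n}
    (hx : 0 < 1 + ⟪u, x⟫) (hxF : x ∈ polarFace K f) :
    polarShift (-u) x ∈ polarFace ((fun x => x + u) '' K) (f + u) := by
  rw [← polarShift_mem_polarFace_iff, polarShift_polarShift_neg hx]
  · exact hxF
  · rw [one_sub_inner_polarShift_neg hx]
    exact inv_pos.2 hx

lemma isExtreme_polarFace {n : ℕ} {K : Set (E n)} {f : E n} (hf : f ∈ K) :
    IsExtreme ℝ (polarBody K) (polarFace K f) := by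
  refine ⟨fun _ hx => hx.1, ?_⟩
  rintro x hx y hy z ⟨-, hz⟩ ⟨a, b, ha, hb, hab, rfl⟩
  refine ⟨hx, ?_⟩
  have h₁ := hx f hf
  have h₂ := hy f hf
  rw [real_inner_comm] at h₁ h₂
  rw [inner_add_left, real_inner_smul_left, real_inner_smul_left] at hz
  nlinarith [mul_le_mul_of_nonneg_left h₂ hb.le]

lemma gauge_polarBody_eq_one {n : ℕ} {K : Set (E n)} {f y : E n} (hf : f ∈ K)
    (hy : y ∈ polarFace K f) : gauge (polarBody K) y = 1 := by
  refine le_antisymm (gauge_le_one_of_mem hy.1) ?_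
  refine le_csInf ⟨1, one_pos, by simpa using hy.1⟩ ?_
  rintro r ⟨hr, z, hz, hzy⟩
  have h := hz f hf
  have hy1 := hy.2
  rw [← hzy, real_inner_smul_left, real_inner_comm] at hy1
  nlinarith

lemma vectorSpan_le_orthogonal_of_inner_eq_one {n : ℕ} {s : Set (E n)} {f : E n}
    (hs : ∀ x ∈ s, ⟪x, f⟫ = 1) : vectorSpan ℝ s ≤ (ℝ ∙ f)ᗮ := by
  rw [vectorSpan_def, Submodule.span_le]
  rintro _ ⟨x, hx, y, hy, rfl⟩
  change x - y ∈ (ℝ ∙ f)ᗮ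
  rw [Submodule.mem_orthogonal_singleton_iff_inner_left, inner_sub_left, hs x hx, hs y hy,
    sub_self]

lemma inner_eq_one_of_mem_affineSpan {n : ℕ} {s : Set (E n)} {f y : E n}
    (hs : ∀ x ∈ s, ⟪x, f⟫ = 1) (hy : y ∈ affineSpan ℝ s) : ⟪y, f⟫ = 1 := by
  obtain ⟨x, hx, w, hw, rfl⟩ := hy
  have := Submodule.mem_orthogonal_singleton_iff_inner_left.1
    (vectorSpan_le_orthogonal_of_inner_eq_one hs hw)
  rw [vadd_eq_add, inner_add_left, this, hs x hx, zero_add]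

lemma finrank_orthogonal_singleton_plane {f : E 2} (hf : f ≠ 0) :
    Module.finrank ℝ (ℝ ∙ f)ᗮ = 1 := by
  have : Fact (Module.finrank ℝ (E 2) = 1 + 1) := ⟨by simp⟩
  exact Submodule.finrank_orthogonal_span_singleton hf

/-- A one-dimensional planar set on the line `⟪·, f⟫ = 1` spans that line. -/
lemma mem_affineSpan_of_inner_eq_one {s : Set (E 2)} {f x y : E 2}
    (hs : ∀ x ∈ s, ⟪x, f⟫ = 1) (hx : x ∈ s)
    (hdim : Module.finrank ℝ (vectorSpan ℝ s) = 1) (hy : ⟪y, f⟫ = 1) :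
    y ∈ affineSpan ℝ s := by
  have hf : f ≠ 0 := by
    rintro rfl
    simp at hy
  have hspan : vectorSpan ℝ s = (ℝ ∙ f)ᗮ :=
    Submodule.eq_of_le_of_finrank_eq (vectorSpan_le_orthogonal_of_inner_eq_one hs)
      (hdim.trans (finrank_orthogonal_singleton_plane hf).symm)
  rw [← AffineSubspace.vsub_left_mem_direction_iff_mem (mem_affineSpan ℝ hx),
    direction_affineSpan, hspan, Submodule.mem_orthogonal_singleton_iff_inner_left, vsub_eq_sub,
    inner_sub_left, hy, hs x hx, sub_self]

lemma finrank_vectorSpan_eq_one_of_nontrivial {s : Set (E 2)} {f : E 2}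
    (hs : ∀ x ∈ s, ⟪x, f⟫ = 1) (hnt : s.Nontrivial) :
    Module.finrank ℝ (vectorSpan ℝ s) = 1 := by
  obtain ⟨x, hx⟩ := hnt.nonempty
  have hf : f ≠ 0 := by
    rintro rfl
    simpa using hs x hx
  have hle := Submodule.finrank_mono (vectorSpan_le_orthogonal_of_inner_eq_one hs)
  rw [finrank_orthogonal_singleton_plane hf] at hle
  refine le_antisymm hle (Nat.one_le_iff_ne_zero.2 fun h => ?_)
  rw [Submodule.finrank_eq_zero, vectorSpan_eq_bot_iff_subsingleton] at h
  exact Set.not_subsingleton_iff.2 hnt h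

lemma mem_intrinsicInterior_iff_eventually {n : ℕ} {s : Set (E n)} {x : E n} (hx : x ∈ s) :
    x ∈ intrinsicInterior ℝ s ↔ ∀ᶠ y in nhds x, y ∈ affineSpan ℝ s → y ∈ s := by
  have hxs : x ∈ affineSpan ℝ s := mem_affineSpan ℝ hx
  have key : (⟨x, hxs⟩ : affineSpan ℝ s) ∈ interior ((↑) ⁻¹' s : Set (affineSpan ℝ s)) ↔
      ∀ᶠ y in nhds x, y ∈ affineSpan ℝ s → y ∈ s := by
    rw [mem_interior_iff_mem_nhds]
    exact (eventually_nhds_subtype_iff (affineSpan ℝ s : Set (E n)) ⟨x, hxs⟩ (· ∈ s)).trans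
      eventually_nhdsWithin_iff
  rw [← key, mem_intrinsicInterior]
  constructor
  · rintro ⟨y, hy, rfl⟩
    exact hy
  · exact fun h => ⟨_, h, rfl⟩

theorem edge_translation (K : Set (E 2)) (hK : IsConvexBody K)
    (h0 : (0 : E 2) ∈ interior K) (u v f : E 2)
    (hu : -u ∈ interior K) (hf : f ∈ Set.extremePoints ℝ K)
    (hE : IsEdge (polarBody K) {x ∈ polarBody K | ⟪x, f⟫ = 1})
    (hv : (gauge (polarBody K) v)⁻¹ • v
            ∈ intrinsicInterior ℝ {x ∈ polarBody K | ⟪x, f⟫ = 1}) :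
    IsEdge (polarBody ((fun x => x + u) '' K))
        {x ∈ polarBody ((fun x => x + u) '' K) | ⟪x, f + u⟫ = 1} ∧
    (gauge (polarBody ((fun x => x + u) '' K)) v)⁻¹ • v
        ∈ intrinsicInterior ℝ
            {x ∈ polarBody ((fun x => x + u) '' K) | ⟪x, f + u⟫ = 1} := by
  obtain ⟨-, hdim⟩ := hE
  set x₀ := (gauge (polarBody K) v)⁻¹ • v with hx₀
  have hx₀F : x₀ ∈ polarFace K f := intrinsicInterior_subset hv
  have hpos : ∀ x ∈ polarFace K f, 0 < 1 + ⟪u, x⟫ := fun x hx => by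
    have := inner_lt_one_of_mem_interior hu hx.1
    rw [inner_neg_left] at this
    linarith
  have hfK : f + u ∈ (fun x => x + u) '' K := ⟨f, hf.1, rfl⟩
  have hc := hpos x₀ hx₀F
  set y₀ := polarShift (-u) x₀ with hy₀
  have hy₀F : y₀ ∈ polarFace ((fun x => x + u) '' K) (f + u) :=
    polarShift_neg_mem_polarFace hc hx₀F
  have hg : 0 < gauge (polarBody K) v := by
    refine (gauge_nonneg v).lt_of_ne fun h => ?_
    have := hx₀F.2
    rw [hx₀, ← h] at this
    simp at this
  have hvy : v = (gauge (polarBody K) v * (1 + ⟪u, x₀⟫)) • y₀ := by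
    rw [hy₀, polarShift, inner_neg_left, sub_neg_eq_add, mul_smul, smul_inv_smul₀ hc.ne', hx₀,
      smul_inv_smul₀ hg.ne']
  have hgauge : (gauge (polarBody ((fun x => x + u) '' K)) v)⁻¹ • v = y₀ := by
    have hgc := mul_pos hg hc
    generalize gauge (polarBody K) v * (1 + ⟪u, x₀⟫) = r at hvy hgc
    rw [hvy, gauge_smul_of_nonneg hgc.le, gauge_polarBody_eq_one hfK hy₀F, smul_eq_mul, mul_one,
      inv_smul_smul₀ hgc.ne']
  refine ⟨⟨isExtreme_polarFace hfK,
    finrank_vectorSpan_eq_one_of_nontrivial (fun _ hx => hx.2) ?_⟩, ?_⟩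
  · have hnt : (polarFace K f).Nontrivial := by
      rw [← Set.not_subsingleton_iff]
      intro h
      rw [vectorSpan_of_subsingleton ℝ h, finrank_bot] at hdim
      exact zero_ne_one hdim
    obtain ⟨a, ha, b, hb, hab⟩ := hnt
    refine ⟨_, polarShift_neg_mem_polarFace (hpos a ha) ha,
      _, polarShift_neg_mem_polarFace (hpos b hb) hb, fun h => hab ?_⟩
    rw [← polarShift_polarShift_neg (hpos a ha), h, polarShift_polarShift_neg (hpos b hb)]
  · rw [hgauge]
    refine (mem_intrinsicInterior_iff_eventually hy₀F).2 ?_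
    have hev := (mem_intrinsicInterior_iff_eventually hx₀F).1 hv
    have hd : 0 < 1 - ⟪u, y₀⟫ := by
      rw [hy₀, one_sub_inner_polarShift_neg hc]
      exact inv_pos.2 hc
    have hcont : Continuous fun y : E 2 => 1 - ⟪u, y⟫ := by fun_prop
    have hshift : Filter.Tendsto (polarShift u) (nhds y₀) (nhds x₀) := by
      have : ContinuousAt (polarShift u) y₀ :=
        (hcont.continuousAt.inv₀ hd.ne').smul continuousAt_id
      rwa [ContinuousAt, hy₀, polarShift_polarShift_neg hc] at this
    filter_upwards [hshift.eventually hev, hcont.continuousAt.eventually (lt_mem_nhds hd)]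
      with y hy hypos hyspan
    refine (polarShift_mem_polarFace_iff hypos).1 <| hy <|
      mem_affineSpan_of_inner_eq_one (fun _ hx => hx.2) hx₀F hdim ?_
    exact (inner_polarShift_eq_one_iff hypos).2
      (inner_eq_one_of_mem_affineSpan (fun _ hx => hx.2) hyspan)
end
end
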